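/- arXiv:0806.0492 — 3 statements merged into one kernel-verified Lean document; each statement's English description precedes it below -/
import Mathlib

section
/- Let 1 ≤ N ≤ 4 and let f ∈ C¹(ℝ) satisfy f ≥ 0 on ℝ. If u ∈ C²(ℝ^N) is a bounded stable solution of −Δu = f(u) in ℝ^N, then u is constant. -/
open MeasureTheory Filter Topology
open scoped ENNReal

/-- The Laplacian of `u : ℝ^N → ℝ`. -/
noncomputable def lap {N : ℕ} (u : EuclideanSpace ℝ (Fin N) → ℝ)
    (x : EuclideanSpace ℝ (Fin N)) : ℝ :=
  ∑ i : Fin N, iteratedFDeriv ℝ 2 u x ![EuclideanSpace.single i 1, EuclideanSpace.single i 1]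

/-- `u` is a stable solution w.r.t. the linearized weight `g = f'`:
`∫ f'(u) φ² ≤ ∫ |∇φ|²` for all `φ ∈ C¹_c(ℝ^N)`. -/
def Stable {N : ℕ} (g : ℝ → ℝ) (u : EuclideanSpace ℝ (Fin N) → ℝ) : Prop :=
  ∀ φ : EuclideanSpace ℝ (Fin N) → ℝ, ContDiff ℝ 1 φ → HasCompactSupport φ →
    ∫ x, g (u x) * (φ x) ^ 2 ≤ ∫ x, ‖gradient φ x‖ ^ 2

/-- `u` is stable outside the set `K` : the stability inequality holds for all
`φ ∈ C¹_c(ℝ^N \ K)`. -/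
def StableOutside {N : ℕ} (g : ℝ → ℝ) (u : EuclideanSpace ℝ (Fin N) → ℝ)
    (K : Set (EuclideanSpace ℝ (Fin N))) : Prop :=
  ∀ φ : EuclideanSpace ℝ (Fin N) → ℝ, ContDiff ℝ 1 φ → HasCompactSupport φ →
    tsupport φ ⊆ Kᶜ →
    ∫ x, g (u x) * (φ x) ^ 2 ≤ ∫ x, ‖gradient φ x‖ ^ 2

/-- The quantity `q(u) = f'(u)²/(f(u) f''(u)) ∈ [0,∞]`, with the convention
`q(u) = +∞` when `f(u) f''(u) = 0`. -/
noncomputable def qfun (f : ℝ → ℝ) (t : ℝ) : ℝ≥0∞ :=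
  if f t * deriv (deriv f) t = 0 then ⊤
  else ENNReal.ofReal ((deriv f t) ^ 2 / (f t * deriv (deriv f) t))

/-- The Joseph–Lundgren exponent `p_c(N)` (for `N ≥ 11`). -/
noncomputable def pc (N : ℕ) : ℝ :=
  (((N : ℝ) - 2) ^ 2 - 4 * N + 8 * Real.sqrt ((N : ℝ) - 1)) / (((N : ℝ) - 2) * ((N : ℝ) - 10))

section Gradient

variable {N : ℕ}

local notation "𝔼" => EuclideanSpace ℝ (Fin N)

lemma continuous_gradient {φ : 𝔼 → ℝ} (hφ : ContDiff ℝ 1 φ) : Continuous (gradient φ) :=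
  (InnerProductSpace.toDual ℝ 𝔼).symm.continuous.comp (hφ.continuous_fderiv one_ne_zero)

lemma gradient_fun_mul {a b : 𝔼 → ℝ} {x : 𝔼} (ha : DifferentiableAt ℝ a x)
    (hb : DifferentiableAt ℝ b x) :
    gradient (fun y => a y * b y) x = a x • gradient b x + b x • gradient a x := by
  simp [gradient, fderiv_fun_mul ha hb]

lemma gradient_fun_const_sub {b : 𝔼 → ℝ} (c : ℝ) (x : 𝔼) :
    gradient (fun y => c - b y) x = -gradient b x := by
  simp [gradient, fderiv_const_sub]

lemma gradient_sqrt_sq_add_sq_add {a b : 𝔼 → ℝ} {x : 𝔼} {ε : ℝ} (hε : 0 < ε)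
    (ha : DifferentiableAt ℝ a x) (hb : DifferentiableAt ℝ b x) :
    gradient (fun y => √(a y ^ 2 + b y ^ 2 + ε)) x =
      (√(a x ^ 2 + b x ^ 2 + ε))⁻¹ • (a x • gradient a x + b x • gradient b x) := by
  have hpos : a x ^ 2 + b x ^ 2 + ε ≠ 0 := by positivity
  have h := (((ha.hasFDerivAt.pow 2).add (hb.hasFDerivAt.pow 2)).add_const ε).sqrt hpos
  have h' : fderiv ℝ (fun y => √(a y ^ 2 + b y ^ 2 + ε)) x = _ := h.fderiv
  simp only [gradient, h', map_smul, map_add]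
  simp only [smul_add, smul_smul]
  congr 2 <;> norm_num <;> ring

lemma gradient_of_notMem_tsupport {φ : 𝔼 → ℝ} {x : 𝔼} (hx : x ∉ tsupport φ) :
    gradient φ x = 0 := by
  simp [gradient, fderiv_of_notMem_tsupport ℝ hx]

lemma integrable_of_eq_zero_of_notMem_tsupport {φ F : 𝔼 → ℝ} (hφ : HasCompactSupport φ)
    (hF : Continuous F) (h : ∀ x ∉ tsupport φ, F x = 0) : Integrable F :=
  hF.integrable_of_hasCompactSupport (HasCompactSupport.intro hφ.isCompact h)

lemma inner_gradient_eq_sum (φ ψ : 𝔼 → ℝ) (x : 𝔼) :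
    inner ℝ (gradient φ x) (gradient ψ x) =
      ∑ i, fderiv ℝ φ x (EuclideanSpace.single i 1) * fderiv ℝ ψ x (EuclideanSpace.single i 1) := by
  rw [← (EuclideanSpace.basisFun (Fin N) ℝ).sum_inner_mul_inner]
  simp [inner_gradient_left, inner_gradient_right]

/-- The partial derivative of `u` in the `i`-th coordinate direction. -/
noncomputable def partialDeriv (i : Fin N) (u : 𝔼 → ℝ) (x : 𝔼) : ℝ :=
  fderiv ℝ u x (EuclideanSpace.single i 1)

lemma contDiff_partialDeriv {u : 𝔼 → ℝ} (hu : ContDiff ℝ 2 u) (i : Fin N) :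
    ContDiff ℝ 1 (partialDeriv i u) :=
  (hu.fderiv_right (m := 1) (by norm_num)).clm_apply contDiff_const

lemma continuous_partialDeriv {u : 𝔼 → ℝ} (hu : ContDiff ℝ 1 u) (i : Fin N) :
    Continuous (partialDeriv i u) :=
  (hu.continuous_fderiv one_ne_zero).clm_apply continuous_const

lemma abs_partialDeriv_le (i : Fin N) (u : 𝔼 → ℝ) (x : 𝔼) :
    |partialDeriv i u x| ≤ ‖gradient u x‖ := by
  have := abs_real_inner_le_norm (gradient u x) (EuclideanSpace.single i 1)
  simpa [inner_gradient_left, partialDeriv] using this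

lemma partialDeriv_of_notMem_tsupport {φ : 𝔼 → ℝ} {x : 𝔼} (i : Fin N) (hx : x ∉ tsupport φ) :
    partialDeriv i φ x = 0 := by
  simp [partialDeriv, fderiv_of_notMem_tsupport ℝ hx]

lemma partialDeriv_partialDeriv {u : 𝔼 → ℝ} (hu : ContDiff ℝ 2 u) (i j : Fin N) (x : 𝔼) :
    partialDeriv i (partialDeriv j u) x =
      fderiv ℝ (fderiv ℝ u) x (EuclideanSpace.single i 1) (EuclideanSpace.single j 1) := by
  have hd : DifferentiableAt ℝ (fderiv ℝ u) x :=
    (hu.fderiv_right (m := 1) (by norm_num)).differentiable one_ne_zero x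
  change fderiv ℝ (fun y => fderiv ℝ u y (EuclideanSpace.single j 1)) x _ = _
  rw [fderiv_clm_apply hd (by fun_prop)]
  simp

lemma partialDeriv_comm {u : 𝔼 → ℝ} (hu : ContDiff ℝ 2 u) (i j : Fin N) (x : 𝔼) :
    partialDeriv i (partialDeriv j u) x = partialDeriv j (partialDeriv i u) x := by
  rw [partialDeriv_partialDeriv hu, partialDeriv_partialDeriv hu]
  exact (hu.contDiffAt.isSymmSndFDerivAt (by simp)).eq _ _

lemma lap_eq_sum {u : 𝔼 → ℝ} (hu : ContDiff ℝ 2 u) (x : 𝔼) :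
    lap u x = ∑ i, partialDeriv i (partialDeriv i u) x := by
  simp [lap, iteratedFDeriv_two_apply, partialDeriv_partialDeriv hu]

/-- Green's identity against a compactly supported test function. -/
lemma integral_inner_gradient_eq {u φ : 𝔼 → ℝ} (hu : ContDiff ℝ 2 u) (hφ : ContDiff ℝ 1 φ)
    (hc : HasCompactSupport φ) :
    ∫ x, inner ℝ (gradient u x) (gradient φ x) = ∫ x, -lap u x * φ x := by
  have hc1 (i : Fin N) : Continuous (partialDeriv i (partialDeriv i u)) :=
    continuous_partialDeriv (contDiff_partialDeriv hu i) i
  have hc2 (i : Fin N) : Continuous (partialDeriv i u) := (contDiff_partialDeriv hu i).continuous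
  have hI1 (i : Fin N) : Integrable (fun x => partialDeriv i (partialDeriv i u) x * φ x) :=
    integrable_of_eq_zero_of_notMem_tsupport hc ((hc1 i).mul hφ.continuous) fun x hx => by
      simp [image_eq_zero_of_notMem_tsupport hx]
  have hI2 (i : Fin N) : Integrable (fun x => partialDeriv i u x * partialDeriv i φ x) :=
    integrable_of_eq_zero_of_notMem_tsupport hc ((hc2 i).mul (continuous_partialDeriv hφ i))
      fun x hx => by simp [partialDeriv_of_notMem_tsupport i hx]
  have hI3 (i : Fin N) : Integrable (fun x => partialDeriv i u x * φ x) :=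
    integrable_of_eq_zero_of_notMem_tsupport hc ((hc2 i).mul hφ.continuous) fun x hx => by
      simp [image_eq_zero_of_notMem_tsupport hx]
  have hparts (i : Fin N) : ∫ x, partialDeriv i u x * partialDeriv i φ x =
      -∫ x, partialDeriv i (partialDeriv i u) x * φ x :=
    integral_mul_fderiv_eq_neg_fderiv_mul_of_integrable (hI1 i) (hI2 i) (hI3 i)
      (fun x _ => (contDiff_partialDeriv hu i).differentiable one_ne_zero x)
      (fun x _ => hφ.differentiable one_ne_zero x)
  simp only [inner_gradient_eq_sum, lap_eq_sum hu, neg_mul, Finset.sum_mul, integral_neg]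
  rw [integral_finsetSum _ fun i _ => hI1 i]
  refine (integral_finsetSum _ fun i _ => hI2 i).trans ?_
  rw [Finset.sum_congr rfl fun i _ => hparts i, Finset.sum_neg_distrib]

/-- Differentiation under the integral sign along a translation. -/
lemma hasDerivAt_integral_comp_add_smul {a b : 𝔼 → ℝ} (ha : ContDiff ℝ 1 a) (hb : Continuous b)
    (hc : HasCompactSupport b) (e : 𝔼) :
    HasDerivAt (fun t : ℝ => ∫ x, a (x + t • e) * b x) (∫ x, fderiv ℝ a x e * b x) 0 := by
  have hda : Continuous fun x => fderiv ℝ a x e :=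
    (ha.continuous_fderiv one_ne_zero).clm_apply continuous_const
  have hK : IsCompact ((fun p : 𝔼 × ℝ => p.1 + p.2 • e) '' (tsupport b ×ˢ Set.Icc (-1) 1)) :=
    (hc.isCompact.prod isCompact_Icc).image (by fun_prop)
  obtain ⟨C, hC⟩ := hK.exists_bound_of_continuousOn hda.continuousOn
  have key := hasDerivAt_integral_of_dominated_loc_of_deriv_le (μ := (volume : Measure 𝔼))
    (F := fun (t : ℝ) x => a (x + t • e) * b x)
    (F' := fun (t : ℝ) x => fderiv ℝ a (x + t • e) e * b x) (x₀ := (0 : ℝ))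
    (s := Set.Icc (-1) 1) (bound := fun x => C * |b x|)
    (Icc_mem_nhds (by norm_num) (by norm_num))
    (Eventually.of_forall fun t =>
      ((ha.continuous.comp (by fun_prop)).mul hb).aestronglyMeasurable)
    (integrable_of_eq_zero_of_notMem_tsupport hc ((ha.continuous.comp (by fun_prop)).mul hb)
      fun x hx => by simp [image_eq_zero_of_notMem_tsupport hx])
    (((hda.comp (by fun_prop)).mul hb).aestronglyMeasurable)
    (Eventually.of_forall fun x t ht => by
      by_cases hx : x ∈ tsupport b
      · rw [norm_mul]
        exact mul_le_mul_of_nonneg_right (hC _ ⟨(x, t), ⟨hx, ht⟩, rfl⟩) (abs_nonneg _)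
      · simp [image_eq_zero_of_notMem_tsupport hx])
    (integrable_of_eq_zero_of_notMem_tsupport hc (by fun_prop)
      fun x hx => by simp [image_eq_zero_of_notMem_tsupport hx])
    (Eventually.of_forall fun x t _ => by
      have h1 : HasDerivAt (fun t : ℝ => x + t • e) e t := by
        simpa using ((hasDerivAt_id t).smul_const e).const_add x
      exact ((ha.differentiable one_ne_zero _).hasFDerivAt.comp_hasDerivAt t h1).mul_const (b x))
  simpa using key.2

/-- The derivatives of a solution of `-Δu = f(u)` solve the linearized equation weakly. -/
lemma integral_inner_gradient_partialDeriv_eq {f : ℝ → ℝ} (hf : ContDiff ℝ 1 f) {u φ : 𝔼 → ℝ}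
    (hu : ContDiff ℝ 2 u) (hsol : ∀ x, -lap u x = f (u x)) (hφ : ContDiff ℝ 1 φ)
    (hc : HasCompactSupport φ) (k : Fin N) :
    ∫ x, inner ℝ (gradient (partialDeriv k u) x) (gradient φ x) =
      ∫ x, deriv f (u x) * partialDeriv k u x * φ x := by
  set e : 𝔼 := EuclideanSpace.single k 1 with he
  have hcφ (i : Fin N) : Continuous (partialDeriv i φ) := continuous_partialDeriv hφ i
  have hsφ (i : Fin N) : HasCompactSupport (partialDeriv i φ) :=
    HasCompactSupport.intro hc.isCompact fun x hx => partialDeriv_of_notMem_tsupport i hx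
  have hGF (t : ℝ) : ∑ i, ∫ x, partialDeriv i u (x + t • e) * partialDeriv i φ x =
      ∫ x, f (u (x + t • e)) * φ x := by
    have hut : ContDiff ℝ 2 fun x => u (x + t • e) := hu.comp (by fun_prop)
    have h := integral_inner_gradient_eq hut hφ hc
    have hl (x : 𝔼) : -lap (fun x => u (x + t • e)) x = f (u (x + t • e)) := by
      rw [← hsol]
      simp only [lap, iteratedFDeriv_comp_add_right]
    simp only [hl, inner_gradient_eq_sum, fderiv_comp_add_right] at h
    rw [← h]
    refine (integral_finsetSum _ fun i _ => ?_).symm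
    refine integrable_of_eq_zero_of_notMem_tsupport hc
      (((contDiff_partialDeriv hu i).continuous.comp (by fun_prop)).mul (hcφ i)) fun x hx => ?_
    rw [partialDeriv_of_notMem_tsupport i hx, mul_zero]
  have hG : HasDerivAt (fun t : ℝ => ∑ i, ∫ x, partialDeriv i u (x + t • e) * partialDeriv i φ x)
      (∑ i, ∫ x, fderiv ℝ (partialDeriv i u) x e * partialDeriv i φ x) 0 :=
    HasDerivAt.fun_sum fun i _ =>
      hasDerivAt_integral_comp_add_smul (contDiff_partialDeriv hu i) (hcφ i) (hsφ i) e
  have hF := hasDerivAt_integral_comp_add_smul (hf.comp (hu.of_le one_le_two)) hφ.continuous hc e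
  have hEq := (hG.congr_of_eventuallyEq (Eventually.of_forall fun t => (hGF t).symm)).unique hF
  have hchain (x : 𝔼) : fderiv ℝ (f ∘ u) x e = deriv f (u x) * partialDeriv k u x := by
    rw [fderiv_comp x (hf.differentiable one_ne_zero _) (hu.differentiable two_ne_zero _)]
    simp [partialDeriv, he, mul_comm]
  simp only [hchain] at hEq
  rw [← hEq]
  simp only [inner_gradient_eq_sum]
  rw [integral_finsetSum]
  · refine Finset.sum_congr rfl fun i _ => ?_
    congr 1
    ext x
    congr 1
    exact partialDeriv_comm hu i k x
  · intro i _
    refine integrable_of_eq_zero_of_notMem_tsupport hc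
      ((continuous_partialDeriv (contDiff_partialDeriv hu k) i).mul (hcφ i)) fun x hx => ?_
    simp [fderiv_of_notMem_tsupport ℝ hx]

/-- `η` is a `C¹` cutoff equal to `1` on `closedBall y r`, vanishing outside `ball y (2 * r)`,
with gradient bounded by `L / r`. -/
structure IsCutoff (L : ℝ) (y : 𝔼) (r : ℝ) (η : 𝔼 → ℝ) : Prop where
  contDiff : ContDiff ℝ 1 η
  nonneg : ∀ x, 0 ≤ η x
  le_one : ∀ x, η x ≤ 1
  eq_one : ∀ x, dist x y ≤ r → η x = 1
  eq_zero : ∀ x, 2 * r ≤ dist x y → η x = 0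
  norm_gradient_le : ∀ x, ‖gradient η x‖ ≤ L / r

lemma exists_isCutoff (N : ℕ) : ∃ L : ℝ, ∀ (y : EuclideanSpace ℝ (Fin N)) (r : ℝ), 0 < r →
    ∃ η, IsCutoff L y r η := by
  let χ : ContDiffBump (0 : EuclideanSpace ℝ (Fin N)) := ⟨1, 2, one_pos, one_lt_two⟩
  have hχ : ContDiff ℝ 1 χ := χ.contDiff
  obtain ⟨L, hL⟩ := (χ.hasCompactSupport.fderiv (𝕜 := ℝ)).exists_bound_of_continuous
    (hχ.continuous_fderiv one_ne_zero)
  refine ⟨L, fun y r hr => ⟨fun x => χ (r⁻¹ • (x - y)), ?_, fun x => χ.nonneg,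
    fun x => χ.le_one, fun x hx => ?_, fun x hx => ?_, fun x => ?_⟩⟩
  · exact hχ.comp (by fun_prop)
  · refine χ.one_of_mem_closedBall ?_
    rw [mem_closedBall_zero_iff, norm_smul, ← dist_eq_norm, norm_inv, Real.norm_of_nonneg hr.le,
      inv_mul_le_iff₀ hr]
    simpa [χ] using hx
  · refine χ.zero_of_le_dist ?_
    rw [dist_zero_right, norm_smul, ← dist_eq_norm, norm_inv, Real.norm_of_nonneg hr.le,
      le_inv_mul_iff₀ hr]
    simpa [χ, mul_comm] using hx
  · have h1 : HasFDerivAt (fun x => r⁻¹ • (x - y))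
        (r⁻¹ • ContinuousLinearMap.id ℝ (EuclideanSpace ℝ (Fin N))) x :=
      ((hasFDerivAt_id x).sub_const y).const_smul r⁻¹
    have h2 := (hχ.differentiable one_ne_zero (r⁻¹ • (x - y))).hasFDerivAt.comp x h1
    have h3 : fderiv ℝ (fun x => χ (r⁻¹ • (x - y))) x = _ := h2.fderiv
    rw [gradient, LinearIsometryEquiv.norm_map, h3, ContinuousLinearMap.comp_smul,
      ContinuousLinearMap.comp_id, norm_smul, norm_inv, Real.norm_of_nonneg hr.le, div_eq_inv_mul]
    exact mul_le_mul_of_nonneg_left (hL _) (inv_nonneg.2 hr.le)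

lemma IsCutoff.hasCompactSupport {L r : ℝ} {y : 𝔼} {η : 𝔼 → ℝ}
    (h : IsCutoff L y r η) : HasCompactSupport η :=
  HasCompactSupport.intro (isCompact_closedBall y (2 * r)) fun x hx =>
    h.eq_zero x (by rw [Metric.mem_closedBall, not_le] at hx; exact hx.le)

lemma IsCutoff.gradient_eq_zero_of_dist_lt {L r : ℝ} {y : 𝔼} {η : 𝔼 → ℝ}
    (h : IsCutoff L y r η) {x : 𝔼} (hx : dist x y < r) :
    gradient η x = 0 := by
  have : η =ᶠ[𝓝 x] fun _ => 1 := by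
    filter_upwards [Metric.isOpen_ball.mem_nhds (Metric.mem_ball.2 hx)] with z hz
    exact h.eq_one z (Metric.mem_ball.1 hz).le
  rw [this.gradient_eq, gradient_fun_const]

lemma IsCutoff.gradient_eq_zero_of_lt_dist {L r : ℝ} {y : 𝔼} {η : 𝔼 → ℝ}
    (h : IsCutoff L y r η) {x : 𝔼} (hx : 2 * r < dist x y) :
    gradient η x = 0 := by
  have : η =ᶠ[𝓝 x] fun _ => 0 := by
    filter_upwards [(isOpen_lt continuous_const (continuous_id.dist continuous_const)).mem_nhds
      hx] with z hz
    exact h.eq_zero z (le_of_lt hz)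
  rw [this.gradient_eq, gradient_fun_const]

lemma IsCutoff.norm_gradient_sq_le {L r : ℝ} {y : 𝔼} {η : 𝔼 → ℝ}
    (h : IsCutoff L y r η) (x : 𝔼) :
    ‖gradient η x‖ ^ 2 ≤ (L / r) ^ 2 :=
  pow_le_pow_left₀ (norm_nonneg _) (h.norm_gradient_le x) 2

/-- Caccioppoli inequality for bounded superharmonic functions. -/
lemma integral_norm_gradient_sq_mul_sq_le {u ζ : 𝔼 → ℝ} {M : ℝ} (hu : ContDiff ℝ 2 u)
    (hM : ∀ x, |u x| ≤ M) (hsuper : ∀ x, 0 ≤ -lap u x) (hζ : ContDiff ℝ 1 ζ)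
    (hc : HasCompactSupport ζ) :
    ∫ x, ‖gradient u x‖ ^ 2 * ζ x ^ 2 ≤ 16 * M ^ 2 * ∫ x, ‖gradient ζ x‖ ^ 2 := by
  have hu1 : ContDiff ℝ 1 u := hu.of_le one_le_two
  have hζd := hζ.differentiable one_ne_zero
  have hud := hu1.differentiable one_ne_zero
  have hφ : ContDiff ℝ 1 fun x => (M - u x) * (ζ x * ζ x) :=
    (contDiff_const.sub hu1).mul (hζ.mul hζ)
  have hφc : HasCompactSupport fun x => (M - u x) * (ζ x * ζ x) :=
    HasCompactSupport.intro hc.isCompact fun x hx => by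
      simp [image_eq_zero_of_notMem_tsupport hx]
  have hcu := continuous_gradient hu1
  have hcζ := continuous_gradient hζ
  have hζ' := hζ.continuous
  have hI1 : Integrable fun x => ‖gradient u x‖ ^ 2 * ζ x ^ 2 :=
    integrable_of_eq_zero_of_notMem_tsupport hc (by fun_prop) fun x hx => by
      simp [image_eq_zero_of_notMem_tsupport hx]
  have hI2 : Integrable fun x => ‖gradient ζ x‖ ^ 2 :=
    integrable_of_eq_zero_of_notMem_tsupport hc (by fun_prop) fun x hx => by
      simp [gradient_of_notMem_tsupport hx]
  have hI3 : Integrable fun x =>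
      inner ℝ (gradient u x) (gradient (fun x => (M - u x) * (ζ x * ζ x)) x) :=
    integrable_of_eq_zero_of_notMem_tsupport hφc (hcu.inner (continuous_gradient hφ))
      fun x hx => by simp [gradient_of_notMem_tsupport hx]
  have hnonneg : 0 ≤ ∫ x, -lap u x * ((M - u x) * (ζ x * ζ x)) :=
    integral_nonneg fun x => mul_nonneg (hsuper x)
      (mul_nonneg (sub_nonneg.2 (le_of_abs_le (hM x))) (mul_self_nonneg _))
  rw [← integral_inner_gradient_eq hu hφ hφc] at hnonneg
  have hpt (x : 𝔼) : inner ℝ (gradient u x) (gradient (fun x => (M - u x) * (ζ x * ζ x)) x) ≤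
      8 * M ^ 2 * ‖gradient ζ x‖ ^ 2 - 1 / 2 * (‖gradient u x‖ ^ 2 * ζ x ^ 2) := by
    rw [gradient_fun_mul ((hud x).const_sub M) ((hζd x).fun_mul (hζd x)),
      gradient_fun_mul (hζd x) (hζd x), gradient_fun_const_sub]
    simp only [inner_add_right, inner_smul_right, inner_neg_right, real_inner_self_eq_norm_sq]
    have hcs := abs_le.1 (abs_real_inner_le_norm (gradient u x) (gradient ζ x))
    have hsq : inner ℝ (gradient u x) (gradient ζ x) ^ 2 ≤
        (‖gradient u x‖ * ‖gradient ζ x‖) ^ 2 := sq_le_sq' hcs.1 hcs.2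
    have hMu : (M - u x) ^ 2 ≤ (2 * M) ^ 2 := by
      have := abs_le.1 (hM x)
      exact sq_le_sq' (by linarith) (by linarith)
    have hcross : 2 * (M - u x) * ζ x * inner ℝ (gradient u x) (gradient ζ x) ≤
        1 / 2 * (‖gradient u x‖ ^ 2 * ζ x ^ 2) + 2 * (M - u x) ^ 2 * ‖gradient ζ x‖ ^ 2 := by
      have h1 : |2 * (M - u x) * ζ x * inner ℝ (gradient u x) (gradient ζ x)| ≤
          |2 * (M - u x) * ζ x| * (‖gradient u x‖ * ‖gradient ζ x‖) := by
        rw [abs_mul]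
        exact mul_le_mul_of_nonneg_left (abs_le.2 hcs) (abs_nonneg _)
      have h2 : |2 * (M - u x) * ζ x| = 2 * |M - u x| * |ζ x| := by
        rw [abs_mul, abs_mul, abs_two]
      rw [h2] at h1
      nlinarith [le_abs_self (2 * (M - u x) * ζ x * inner ℝ (gradient u x) (gradient ζ x)),
        sq_nonneg (‖gradient u x‖ * |ζ x| - 2 * |M - u x| * ‖gradient ζ x‖),
        sq_abs (ζ x), sq_abs (M - u x)]
    nlinarith [mul_le_mul_of_nonneg_right hMu (sq_nonneg ‖gradient ζ x‖)]
  have hmono := integral_mono hI3 ((hI2.const_mul _).sub (hI1.const_mul _)) hpt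
  rw [integral_sub' (hI2.const_mul _) (hI1.const_mul _)] at hmono
  simp only [integral_const_mul] at hmono
  linarith

/-- In dimension at most four the energy of a bounded superharmonic function, weighted by the
squared gradient of a cutoff, is bounded uniformly in the scale of the cutoff. -/
lemma exists_integral_norm_gradient_sq_mul_le (hN4 : N ≤ 4) {u : 𝔼 → ℝ} {M L : ℝ}
    (hu : ContDiff ℝ 2 u) (hM : ∀ x, |u x| ≤ M) (hsuper : ∀ x, 0 ≤ -lap u x)
    (hL : ∀ (y : 𝔼) (r : ℝ), 0 < r → ∃ η, IsCutoff L y r η) :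
    ∃ C : ℝ, ∀ (y : 𝔼) (r : ℝ) (η : 𝔼 → ℝ), 1 ≤ r → IsCutoff L y r η →
      ∫ x, ‖gradient u x‖ ^ 2 * ‖gradient η x‖ ^ 2 ≤ C := by
  set V : ℝ := volume.real (Metric.ball (0 : 𝔼) 1) with hV
  refine ⟨1024 * M ^ 2 * L ^ 4 * V, fun y r η hr hη => ?_⟩
  have hr0 : 0 < r := one_pos.trans_le hr
  obtain ⟨ζ, hζ⟩ := hL y (2 * r) (by positivity)
  have hcu := continuous_gradient (hu.of_le one_le_two)
  have hcζ := continuous_gradient hζ.contDiff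
  have hcη := continuous_gradient hη.contDiff
  have hζ' := hζ.contDiff.continuous
  have hI1 : Integrable fun x => ‖gradient u x‖ ^ 2 * ζ x ^ 2 :=
    integrable_of_eq_zero_of_notMem_tsupport hζ.hasCompactSupport (by fun_prop) fun x hx => by
      simp [image_eq_zero_of_notMem_tsupport hx]
  have hI2 : Integrable fun x => ‖gradient ζ x‖ ^ 2 :=
    integrable_of_eq_zero_of_notMem_tsupport hζ.hasCompactSupport (by fun_prop) fun x hx => by
      simp [gradient_of_notMem_tsupport hx]
  have hI3 : Integrable fun x => ‖gradient u x‖ ^ 2 * ‖gradient η x‖ ^ 2 :=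
    integrable_of_eq_zero_of_notMem_tsupport hη.hasCompactSupport (by fun_prop) fun x hx => by
      simp [gradient_of_notMem_tsupport hx]
  have h1 : ∫ x, ‖gradient u x‖ ^ 2 * ‖gradient η x‖ ^ 2 ≤
      (L / r) ^ 2 * ∫ x, ‖gradient u x‖ ^ 2 * ζ x ^ 2 := by
    rw [← integral_const_mul]
    refine integral_mono hI3 (hI1.const_mul _) fun x => ?_
    rcases le_or_gt (dist x y) (2 * r) with hx | hx
    · simp only [hζ.eq_one x hx]
      nlinarith [mul_le_mul_of_nonneg_left (hη.norm_gradient_sq_le x)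
        (sq_nonneg ‖gradient u x‖)]
    · simp only [hη.gradient_eq_zero_of_lt_dist hx]
      have : 0 ≤ (L / r) ^ 2 * (‖gradient u x‖ ^ 2 * ζ x ^ 2) := by positivity
      simpa using this
  have h2 := integral_norm_gradient_sq_mul_sq_le hu hM hsuper hζ.contDiff hζ.hasCompactSupport
  have h3 : ∫ x, ‖gradient ζ x‖ ^ 2 ≤ (L / (2 * r)) ^ 2 * ((4 * r) ^ 4 * V) := by
    have hsupp : ∀ x ∉ Metric.closedBall y (4 * r), ‖gradient ζ x‖ ^ 2 = 0 := fun x hx => by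
      rw [Metric.mem_closedBall, not_le] at hx
      simp [hζ.gradient_eq_zero_of_lt_dist (by linarith : 2 * (2 * r) < dist x y)]
    rw [← setIntegral_eq_integral_of_forall_compl_eq_zero hsupp]
    have hfin : volume (Metric.closedBall y (4 * r)) < ⊤ := measure_closedBall_lt_top
    calc ∫ x in Metric.closedBall y (4 * r), ‖gradient ζ x‖ ^ 2
        ≤ ∫ _ in Metric.closedBall y (4 * r), (L / (2 * r)) ^ 2 :=
          integral_mono hI2.integrableOn (integrableOn_const hfin.ne) hζ.norm_gradient_sq_le
      _ = (L / (2 * r)) ^ 2 * ((4 * r) ^ N * V) := by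
          rw [setIntegral_const, Measure.addHaar_real_closedBall _ _ (by positivity),
            finrank_euclideanSpace_fin, smul_eq_mul, mul_comm]
      _ ≤ (L / (2 * r)) ^ 2 * ((4 * r) ^ 4 * V) := by
          have : (4 * r) ^ N ≤ (4 * r) ^ 4 := pow_le_pow_right₀ (by linarith) hN4
          have hV0 : 0 ≤ V := measureReal_nonneg
          gcongr
  calc ∫ x, ‖gradient u x‖ ^ 2 * ‖gradient η x‖ ^ 2
      ≤ (L / r) ^ 2 * (16 * M ^ 2 * ((L / (2 * r)) ^ 2 * ((4 * r) ^ 4 * V))) := by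
        refine h1.trans (mul_le_mul_of_nonneg_left (h2.trans ?_) (sq_nonneg _))
        exact mul_le_mul_of_nonneg_left h3 (by positivity)
    _ = 1024 * M ^ 2 * L ^ 4 * V := by
        field_simp
        ring

lemma norm_sum_range_sq_eq {w : ℕ → 𝔼} (hw : ∀ i j, i < j → w i = 0 ∨ w j = 0) (k : ℕ) :
    ‖∑ j ∈ Finset.range k, w j‖ ^ 2 = ∑ j ∈ Finset.range k, ‖w j‖ ^ 2 := by
  induction k with
  | zero => simp
  | succ k ih =>
    rw [Finset.sum_range_succ, Finset.sum_range_succ, ← ih]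
    by_cases hk : w k = 0
    · simp [hk]
    · rw [Finset.sum_eq_zero fun i hi => (hw i k (Finset.mem_range.1 hi)).resolve_right hk]
      simp

/-- Averaging cutoffs over many disjoint scales yields logarithmically small energy. -/
lemma exists_cutoff_integral_le {C L : ℝ} {u : 𝔼 → ℝ} (hu : ContDiff ℝ 1 u)
    (hL : ∀ (y : 𝔼) (r : ℝ), 0 < r → ∃ η, IsCutoff L y r η)
    (hC : ∀ (y : 𝔼) (r : ℝ) (η : 𝔼 → ℝ), 1 ≤ r → IsCutoff L y r η →
      ∫ x, ‖gradient u x‖ ^ 2 * ‖gradient η x‖ ^ 2 ≤ C) (y : 𝔼) (k : ℕ) (hk : 0 < k) :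
    ∃ η : 𝔼 → ℝ, ContDiff ℝ 1 η ∧ HasCompactSupport η ∧ (∀ x, dist x y ≤ 1 → η x = 1) ∧
      ∫ x, ‖gradient u x‖ ^ 2 * ‖gradient η x‖ ^ 2 ≤ C / k := by
  have hk0 : (k : ℝ) ≠ 0 := by positivity
  choose η hη using fun j : ℕ => hL y (4 ^ j) (by positivity)
  have h4 (j : ℕ) : (1 : ℝ) ≤ 4 ^ j := one_le_pow₀ (by norm_num)
  have hI (j : ℕ) : Integrable fun x => ‖gradient u x‖ ^ 2 * ‖gradient (η j) x‖ ^ 2 := by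
    have hcu := continuous_gradient hu
    have hcη := continuous_gradient (hη j).contDiff
    exact integrable_of_eq_zero_of_notMem_tsupport (hη j).hasCompactSupport (by fun_prop)
      fun x hx => by simp [gradient_of_notMem_tsupport hx]
  have hgrad (x : 𝔼) : gradient (fun x => (k : ℝ)⁻¹ * ∑ j ∈ Finset.range k, η j x) x =
      (k : ℝ)⁻¹ • ∑ j ∈ Finset.range k, gradient (η j) x := by
    have hd (j : ℕ) : DifferentiableAt ℝ (η j) x := (hη j).contDiff.differentiable one_ne_zero x
    have hs : DifferentiableAt ℝ (fun x => ∑ j ∈ Finset.range k, η j x) x :=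
      DifferentiableAt.fun_sum fun j _ => hd j
    have h1 : fderiv ℝ (fun x => (k : ℝ)⁻¹ * ∑ j ∈ Finset.range k, η j x) x =
        (k : ℝ)⁻¹ • ∑ j ∈ Finset.range k, fderiv ℝ (η j) x := by
      rw [← fderiv_fun_sum fun j _ => hd j]
      exact fderiv_const_mul hs _
    rw [gradient, h1, map_smul, map_sum]
    rfl
  have hdisj (x : 𝔼) (i j : ℕ) (hij : i < j) : gradient (η i) x = 0 ∨ gradient (η j) x = 0 := by
    rcases lt_or_ge (dist x y) (4 ^ j) with hx | hx
    · exact Or.inr ((hη j).gradient_eq_zero_of_dist_lt hx)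
    · refine Or.inl ((hη i).gradient_eq_zero_of_lt_dist (lt_of_lt_of_le ?_ hx))
      have : (4 : ℝ) ^ (i + 1) ≤ 4 ^ j := pow_le_pow_right₀ (by norm_num) hij
      rw [pow_succ] at this
      linarith [h4 i]
  refine ⟨fun x => (k : ℝ)⁻¹ * ∑ j ∈ Finset.range k, η j x, ?_, ?_, fun x hx => ?_, ?_⟩
  · exact contDiff_const.mul (ContDiff.sum fun j _ => (hη j).contDiff)
  · refine HasCompactSupport.intro (isCompact_closedBall y (2 * 4 ^ k)) fun x hx => ?_
    rw [Metric.mem_closedBall, not_le] at hx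
    rw [Finset.sum_eq_zero fun j hj => ?_, mul_zero]
    refine (hη j).eq_zero x (le_trans ?_ hx.le)
    gcongr
    · norm_num
    · exact (Finset.mem_range.1 hj).le
  · simp [(hη _).eq_one x (hx.trans (h4 _)), hk0]
  · calc ∫ x, ‖gradient u x‖ ^ 2 *
          ‖gradient (fun x => (k : ℝ)⁻¹ * ∑ j ∈ Finset.range k, η j x) x‖ ^ 2
        = ∫ x, ((k : ℝ)⁻¹) ^ 2 *
            ∑ j ∈ Finset.range k, ‖gradient u x‖ ^ 2 * ‖gradient (η j) x‖ ^ 2 := by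
          congr 1
          ext x
          rw [hgrad, norm_smul, mul_pow, norm_sum_range_sq_eq (hdisj x), ← Finset.mul_sum,
            norm_inv, RCLike.norm_natCast]
          ring
      _ = ((k : ℝ)⁻¹) ^ 2 *
            ∑ j ∈ Finset.range k, ∫ x, ‖gradient u x‖ ^ 2 * ‖gradient (η j) x‖ ^ 2 := by
          rw [integral_const_mul, integral_finsetSum _ fun j _ => hI j]
      _ ≤ ((k : ℝ)⁻¹) ^ 2 * ∑ _j ∈ Finset.range k, C := by
          gcongr with j _
          exact hC y _ _ (h4 j) (hη j)
      _ = C / k := by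
          rw [Finset.sum_const, Finset.card_range, nsmul_eq_mul]
          field_simp

lemma norm_sq_lagrange (a b : ℝ) (A B : 𝔼) :
    ‖b • A - a • B‖ ^ 2 + ‖a • A + b • B‖ ^ 2 = (a ^ 2 + b ^ 2) * (‖A‖ ^ 2 + ‖B‖ ^ 2) := by
  rw [norm_sub_sq_real, norm_add_sq_real]
  simp only [norm_smul, inner_smul_left, inner_smul_right, mul_pow, Real.norm_eq_abs, sq_abs]
  simp
  ring

/-- A Sternberg–Zumbrun type inequality for a pair of weak solutions of the linearized equation,
obtained from the test function `√(a² + b² + ε) η`. -/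
lemma integral_sternberg_zumbrun_le {c a b η : 𝔼 → ℝ} {ε : ℝ} (hε : 0 < ε) (hc : Continuous c)
    (ha : ContDiff ℝ 1 a) (hb : ContDiff ℝ 1 b) (hη : ContDiff ℝ 1 η) (hηc : HasCompactSupport η)
    (hstab : ∀ φ : 𝔼 → ℝ, ContDiff ℝ 1 φ → HasCompactSupport φ →
      ∫ x, c x * φ x ^ 2 ≤ ∫ x, ‖gradient φ x‖ ^ 2)
    (hla : ∀ φ : 𝔼 → ℝ, ContDiff ℝ 1 φ → HasCompactSupport φ →
      ∫ x, inner ℝ (gradient a x) (gradient φ x) = ∫ x, c x * a x * φ x)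
    (hlb : ∀ φ : 𝔼 → ℝ, ContDiff ℝ 1 φ → HasCompactSupport φ →
      ∫ x, inner ℝ (gradient b x) (gradient φ x) = ∫ x, c x * b x * φ x) :
    ∫ x, η x ^ 2 * ‖b x • gradient a x - a x • gradient b x‖ ^ 2 / (a x ^ 2 + b x ^ 2 + ε) ≤
      (∫ x, (a x ^ 2 + b x ^ 2) * ‖gradient η x‖ ^ 2) +
        ε * ((∫ x, ‖gradient η x‖ ^ 2) - ∫ x, c x * η x ^ 2) := by
  have hpos (x : 𝔼) : 0 < a x ^ 2 + b x ^ 2 + ε := by positivity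
  have had := ha.differentiable one_ne_zero
  have hbd := hb.differentiable one_ne_zero
  have hηd := hη.differentiable one_ne_zero
  have hw : ContDiff ℝ 1 fun x => √(a x ^ 2 + b x ^ 2 + ε) :=
    (((ha.pow 2).add (hb.pow 2)).add contDiff_const).sqrt fun x => (hpos x).ne'
  have hwd := hw.differentiable one_ne_zero
  have hφ : ContDiff ℝ 1 fun x => √(a x ^ 2 + b x ^ 2 + ε) * η x := hw.mul hη
  have hφa : ContDiff ℝ 1 fun x => a x * (η x * η x) := ha.mul (hη.mul hη)
  have hφb : ContDiff ℝ 1 fun x => b x * (η x * η x) := hb.mul (hη.mul hη)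
  have hs : ∀ g : 𝔼 → ℝ, HasCompactSupport fun x => g x * η x := fun g =>
    HasCompactSupport.intro hηc.isCompact fun x hx => by
      simp [image_eq_zero_of_notMem_tsupport hx]
  have hs2 : ∀ g : 𝔼 → ℝ, HasCompactSupport fun x => g x * (η x * η x) := fun g =>
    HasCompactSupport.intro hηc.isCompact fun x hx => by
      simp [image_eq_zero_of_notMem_tsupport hx]
  have hca := ha.continuous
  have hcb := hb.continuous
  have hcη := hη.continuous
  have hga := continuous_gradient ha
  have hgb := continuous_gradient hb
  have hgη := continuous_gradient hη
  have hI0 : Integrable fun x => η x ^ 2 * ‖b x • gradient a x - a x • gradient b x‖ ^ 2 /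
      (a x ^ 2 + b x ^ 2 + ε) :=
    integrable_of_eq_zero_of_notMem_tsupport hηc
      (Continuous.div (by fun_prop) (by fun_prop) fun x => (hpos x).ne')
      fun x hx => by simp [image_eq_zero_of_notMem_tsupport hx]
  have hI1 : Integrable fun x => ‖gradient (fun x => √(a x ^ 2 + b x ^ 2 + ε) * η x) x‖ ^ 2 :=
    integrable_of_eq_zero_of_notMem_tsupport (hs fun x => √(a x ^ 2 + b x ^ 2 + ε))
      ((continuous_gradient hφ).norm.pow 2)
      fun x hx => by simp [gradient_of_notMem_tsupport hx]
  have hI2 : Integrable fun x =>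
      inner ℝ (gradient a x) (gradient (fun x => a x * (η x * η x)) x) :=
    integrable_of_eq_zero_of_notMem_tsupport (hs2 a) (hga.inner (continuous_gradient hφa))
      fun x hx => by simp [gradient_of_notMem_tsupport hx]
  have hI3 : Integrable fun x =>
      inner ℝ (gradient b x) (gradient (fun x => b x * (η x * η x)) x) :=
    integrable_of_eq_zero_of_notMem_tsupport (hs2 b) (hgb.inner (continuous_gradient hφb))
      fun x hx => by simp [gradient_of_notMem_tsupport hx]
  have hI4 : Integrable fun x => (a x ^ 2 + b x ^ 2) * ‖gradient η x‖ ^ 2 :=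
    integrable_of_eq_zero_of_notMem_tsupport hηc (by fun_prop)
      fun x hx => by simp [gradient_of_notMem_tsupport hx]
  have hI5 : Integrable fun x => ‖gradient η x‖ ^ 2 :=
    integrable_of_eq_zero_of_notMem_tsupport hηc (by fun_prop)
      fun x hx => by simp [gradient_of_notMem_tsupport hx]
  have hI6 : Integrable fun x => c x * a x * (a x * (η x * η x)) :=
    integrable_of_eq_zero_of_notMem_tsupport hηc (by fun_prop)
      fun x hx => by simp [image_eq_zero_of_notMem_tsupport hx]
  have hI7 : Integrable fun x => c x * b x * (b x * (η x * η x)) :=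
    integrable_of_eq_zero_of_notMem_tsupport hηc (by fun_prop)
      fun x hx => by simp [image_eq_zero_of_notMem_tsupport hx]
  have hI8 : Integrable fun x => c x * η x ^ 2 :=
    integrable_of_eq_zero_of_notMem_tsupport hηc (by fun_prop)
      fun x hx => by simp [image_eq_zero_of_notMem_tsupport hx]
  have hpt (x : 𝔼) : η x ^ 2 * ‖b x • gradient a x - a x • gradient b x‖ ^ 2 /
        (a x ^ 2 + b x ^ 2 + ε) + ‖gradient (fun x => √(a x ^ 2 + b x ^ 2 + ε) * η x) x‖ ^ 2 ≤
      inner ℝ (gradient a x) (gradient (fun x => a x * (η x * η x)) x) +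
        inner ℝ (gradient b x) (gradient (fun x => b x * (η x * η x)) x) +
        ((a x ^ 2 + b x ^ 2) * ‖gradient η x‖ ^ 2 + ε * ‖gradient η x‖ ^ 2) := by
    rw [gradient_fun_mul (hwd x) (hηd x), gradient_fun_mul (had x) ((hηd x).fun_mul (hηd x)),
      gradient_fun_mul (hbd x) ((hηd x).fun_mul (hηd x)), gradient_fun_mul (hηd x) (hηd x),
      gradient_sqrt_sq_add_sq_add hε (had x) (hbd x)]
    have hlag := norm_sq_lagrange (a x) (b x) (gradient a x) (gradient b x)
    have hP : inner ℝ (gradient η x) (a x • gradient a x + b x • gradient b x) =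
        a x * inner ℝ (gradient a x) (gradient η x) +
          b x * inner ℝ (gradient b x) (gradient η x) := by
      rw [inner_add_right, inner_smul_right, inner_smul_right, real_inner_comm (gradient η x),
        real_inner_comm (gradient η x)]
    have hsq : √(a x ^ 2 + b x ^ 2 + ε) ^ 2 = a x ^ 2 + b x ^ 2 + ε := Real.sq_sqrt (hpos x).le
    have hspos : 0 < √(a x ^ 2 + b x ^ 2 + ε) := Real.sqrt_pos.2 (hpos x)
    set W := √(a x ^ 2 + b x ^ 2 + ε)
    set P := a x • gradient a x + b x • gradient b x
    have hexp : ‖W • gradient η x + η x • W⁻¹ • P‖ ^ 2 = W ^ 2 * ‖gradient η x‖ ^ 2 +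
        2 * η x * inner ℝ (gradient η x) P + η x ^ 2 * ‖P‖ ^ 2 / W ^ 2 := by
      rw [norm_add_sq_real]
      simp only [norm_smul, inner_smul_left, inner_smul_right, mul_pow, Real.norm_eq_abs, sq_abs,
        inv_pow, abs_inv]
      simp
      field_simp
    rw [hexp, hP, hsq]
    simp only [inner_add_right, inner_smul_right, real_inner_self_eq_norm_sq]
    have hfrac : η x ^ 2 * ‖b x • gradient a x - a x • gradient b x‖ ^ 2 /
          (a x ^ 2 + b x ^ 2 + ε) + η x ^ 2 * ‖P‖ ^ 2 / (a x ^ 2 + b x ^ 2 + ε) ≤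
        η x ^ 2 * (‖gradient a x‖ ^ 2 + ‖gradient b x‖ ^ 2) := by
      rw [← add_div, ← mul_add, hlag, div_le_iff₀ (hpos x)]
      have : 0 ≤ ε * (η x ^ 2 * (‖gradient a x‖ ^ 2 + ‖gradient b x‖ ^ 2)) := by positivity
      linarith
    linarith
  have hmono := integral_mono (hI0.add hI1) ((hI2.add hI3).add (hI4.add (hI5.const_mul ε))) hpt
  rw [integral_add' hI0 hI1, integral_add' (hI2.add hI3) (hI4.add (hI5.const_mul ε)),
    integral_add' hI2 hI3, integral_add' hI4 (hI5.const_mul ε), integral_const_mul,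
    hla _ hφa (hs2 _), hlb _ hφb (hs2 _)] at hmono
  have hst := hstab _ hφ (hs _)
  have hsplit : ∫ x, c x * (√(a x ^ 2 + b x ^ 2 + ε) * η x) ^ 2 =
      (∫ x, c x * a x * (a x * (η x * η x))) + (∫ x, c x * b x * (b x * (η x * η x))) +
        ε * ∫ x, c x * η x ^ 2 := by
    rw [← integral_const_mul, ← integral_add hI6 hI7,
      ← integral_add (by exact hI6.add hI7) (hI8.const_mul ε)]
    congr 1
    ext x
    rw [mul_pow, Real.sq_sqrt (hpos x).le]
    ring
  linarith

/-- Under the energy bound, any two derivatives of a stable solution are locally proportional. -/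
lemma smul_gradient_eq_smul_gradient {c a b u : 𝔼 → ℝ} {C L : ℝ} (hc : Continuous c)
    (hu : ContDiff ℝ 1 u) (ha : ContDiff ℝ 1 a) (hb : ContDiff ℝ 1 b)
    (hau : ∀ x, |a x| ≤ ‖gradient u x‖) (hbu : ∀ x, |b x| ≤ ‖gradient u x‖)
    (hL : ∀ (y : 𝔼) (r : ℝ), 0 < r → ∃ η, IsCutoff L y r η)
    (hC : ∀ (y : 𝔼) (r : ℝ) (η : 𝔼 → ℝ), 1 ≤ r → IsCutoff L y r η →
      ∫ x, ‖gradient u x‖ ^ 2 * ‖gradient η x‖ ^ 2 ≤ C)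
    (hstab : ∀ φ : 𝔼 → ℝ, ContDiff ℝ 1 φ → HasCompactSupport φ →
      ∫ x, c x * φ x ^ 2 ≤ ∫ x, ‖gradient φ x‖ ^ 2)
    (hla : ∀ φ : 𝔼 → ℝ, ContDiff ℝ 1 φ → HasCompactSupport φ →
      ∫ x, inner ℝ (gradient a x) (gradient φ x) = ∫ x, c x * a x * φ x)
    (hlb : ∀ φ : 𝔼 → ℝ, ContDiff ℝ 1 φ → HasCompactSupport φ →
      ∫ x, inner ℝ (gradient b x) (gradient φ x) = ∫ x, c x * b x * φ x) (y : 𝔼) :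
    b y • gradient a y = a y • gradient b y := by
  have hca := ha.continuous
  have hcb := hb.continuous
  have hga := continuous_gradient ha
  have hgb := continuous_gradient hb
  have hgu := continuous_gradient hu
  set J : 𝔼 → ℝ := fun x => ‖b x • gradient a x - a x • gradient b x‖ ^ 2 with hJ
  have hJc : Continuous J := by fun_prop
  have hJ0 (x : 𝔼) : 0 ≤ J x := sq_nonneg _
  obtain ⟨θ, hθ⟩ := hL y (1 / 2) (by norm_num)
  have hθc := hθ.contDiff.continuous
  obtain ⟨m, hm⟩ := (isCompact_closedBall y 1).exists_bound_of_continuousOn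
    (f := fun x => a x ^ 2 + b x ^ 2 + 1) (by fun_prop)
  have hm0 : 0 < m := lt_of_lt_of_le (by positivity)
    ((le_abs_self _).trans (hm y (Metric.mem_closedBall_self zero_le_one)))
  have hIθ : Integrable fun x => θ x * J x :=
    integrable_of_eq_zero_of_notMem_tsupport hθ.hasCompactSupport (by fun_prop)
      fun x hx => by simp [image_eq_zero_of_notMem_tsupport hx]
  have hbound (k : ℕ) (hk : 0 < k) : ∫ x, θ x * J x ≤ m * (2 * (C / k)) := by
    obtain ⟨η, hη, hηc, hη1, hηC⟩ := exists_cutoff_integral_le hu hL hC y k hk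
    have hηcont := hη.continuous
    have hgη := continuous_gradient hη
    have hI1 : Integrable fun x => ‖gradient u x‖ ^ 2 * ‖gradient η x‖ ^ 2 :=
      integrable_of_eq_zero_of_notMem_tsupport hηc (by fun_prop)
        fun x hx => by simp [gradient_of_notMem_tsupport hx]
    have hI2 : Integrable fun x => (a x ^ 2 + b x ^ 2) * ‖gradient η x‖ ^ 2 :=
      integrable_of_eq_zero_of_notMem_tsupport hηc (by fun_prop)
        fun x hx => by simp [gradient_of_notMem_tsupport hx]
    have henergy : ∫ x, (a x ^ 2 + b x ^ 2) * ‖gradient η x‖ ^ 2 ≤ 2 * (C / k) := by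
      refine le_trans ?_ (mul_le_mul_of_nonneg_left hηC zero_le_two)
      rw [← integral_const_mul]
      refine integral_mono hI2 (hI1.const_mul 2) fun x => ?_
      have h1 := sq_le_sq' (by linarith [neg_abs_le (a x), hau x]) ((le_abs_self _).trans (hau x))
      have h2 := sq_le_sq' (by linarith [neg_abs_le (b x), hbu x]) ((le_abs_self _).trans (hbu x))
      nlinarith [mul_le_mul_of_nonneg_right (add_le_add h1 h2) (sq_nonneg ‖gradient η x‖)]
    set Z : ℝ := (∫ x, ‖gradient η x‖ ^ 2) - ∫ x, c x * η x ^ 2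
    have hε (ε : ℝ) (hε0 : 0 < ε) (hε1 : ε ≤ 1) :
        ∫ x, θ x * J x ≤ m * (2 * (C / k) + ε * Z) := by
      have hpos (x : 𝔼) : 0 < a x ^ 2 + b x ^ 2 + ε := by positivity
      have hI0 : Integrable fun x => η x ^ 2 * J x / (a x ^ 2 + b x ^ 2 + ε) :=
        integrable_of_eq_zero_of_notMem_tsupport hηc
          (Continuous.div (by fun_prop) (by fun_prop) fun x => (hpos x).ne')
          fun x hx => by simp [image_eq_zero_of_notMem_tsupport hx]
      have hsz := integral_sternberg_zumbrun_le hε0 hc ha hb hη hηc hstab hla hlb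
      have hle : ∫ x, θ x * J x ≤ m * ∫ x, η x ^ 2 * J x / (a x ^ 2 + b x ^ 2 + ε) := by
        rw [← integral_const_mul]
        refine integral_mono hIθ (hI0.const_mul m) fun x => ?_
        rcases le_or_gt (dist x y) 1 with hx | hx
        · simp only [hη1 x hx, one_pow, one_mul]
          have hmx : a x ^ 2 + b x ^ 2 + ε ≤ m := by
            linarith [(le_abs_self _).trans (hm x (Metric.mem_closedBall.2 hx))]
          rw [mul_div_assoc', le_div_iff₀ (hpos x)]
          calc θ x * J x * (a x ^ 2 + b x ^ 2 + ε) ≤ 1 * J x * m := by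
                have := hJ0 x
                have := hθ.le_one x
                have := hθ.nonneg x
                have := (hpos x).le
                gcongr
            _ = m * J x := by ring
        · simp only [hθ.eq_zero x (by linarith), zero_mul]
          have := hJ0 x
          have := hpos x
          positivity
      refine hle.trans (mul_le_mul_of_nonneg_left ?_ hm0.le)
      exact hsz.trans (add_le_add_left henergy _)
    refine ge_of_tendsto (x := 𝓝[>] (0 : ℝ)) (f := fun ε => m * (2 * (C / k) + ε * Z)) ?_ ?_
    · have : Continuous fun ε : ℝ => m * (2 * (C / k) + ε * Z) := by fun_prop
      simpa using (this.tendsto 0).mono_left nhdsWithin_le_nhds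
    · filter_upwards [Ioc_mem_nhdsGT (zero_lt_one' ℝ)] with ε h
      exact hε ε h.1 h.2
  have hle0 : ∫ x, θ x * J x ≤ 0 := by
    refine ge_of_tendsto (x := atTop) (f := fun k : ℕ => m * (2 * (C / k))) ?_ ?_
    · simpa using ((tendsto_const_div_atTop_nhds_zero_nat C).const_mul 2).const_mul m
    · filter_upwards [eventually_gt_atTop 0] with k hk
      exact hbound k hk
  by_contra hne
  have hJy : J y ≠ 0 := by
    simpa [hJ, sub_eq_zero] using hne
  refine hle0.not_gt (Continuous.integral_pos_of_hasCompactSupport_nonneg_nonzero (x := y)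
    (by fun_prop) ?_ (fun x => mul_nonneg (hθ.nonneg x) (hJ0 x)) ?_)
  · exact HasCompactSupport.intro hθ.hasCompactSupport.isCompact fun x hx => by
      simp [image_eq_zero_of_notMem_tsupport hx]
  · simpa [hθ.eq_one y (by simp)] using hJy

/-- A bounded function on the line whose second derivative is nonpositive wherever the first one
does not vanish has vanishing derivative. -/
lemma deriv_eq_zero_of_bounded {h h' h'' : ℝ → ℝ} {M : ℝ} (hd : ∀ t, HasDerivAt h (h' t) t)
    (hd' : ∀ t, HasDerivAt h' (h'' t) t) (hc : Continuous h'') (hM : ∀ t, |h t| ≤ M)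
    (hneg : ∀ t, h' t ≠ 0 → h'' t ≤ 0) (t : ℝ) : h' t = 0 := by
  have hle (s : ℝ) : h'' s ≤ 0 := by
    by_contra! hs
    have h1 : ∀ᶠ z in 𝓝[≠] s, 0 < h'' z :=
      (hc.continuousAt.eventually (lt_mem_nhds hs)).filter_mono nhdsWithin_le_nhds
    obtain ⟨z, hz, hz'⟩ := (h1.and ((hd' s).eventually_ne hs.ne' (c := 0))).exists
    exact (hneg z hz').not_gt hz
  have hanti : Antitone h' := antitone_of_deriv_nonpos (fun s => (hd' s).differentiableAt)
    fun s => (hd' s).deriv ▸ hle s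
  have hcont : Continuous h := continuous_iff_continuousAt.2 fun s => (hd s).continuousAt
  have hM0 : 0 ≤ M := (abs_nonneg _).trans (hM 0)
  rcases lt_trichotomy (h' t) 0 with ht | ht | ht
  · exfalso
    have hpos : 0 < (2 * M + 1) / -h' t := div_pos (by linarith) (by linarith)
    obtain ⟨ξ, hξ, hslope⟩ := exists_hasDerivAt_eq_slope h h'
      (show t < t + (2 * M + 1) / -h' t by linarith) hcont.continuousOn fun x _ => hd x
    have h1 := hanti hξ.1.le
    rw [hslope, add_sub_cancel_left, div_le_iff₀ hpos, mul_div_assoc', le_div_iff₀ (by linarith)]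
      at h1
    have h2 := abs_le.1 (hM t)
    have h3 := abs_le.1 (hM (t + (2 * M + 1) / -h' t))
    nlinarith
  · exact ht
  · exfalso
    have hpos : 0 < (2 * M + 1) / h' t := div_pos (by linarith) ht
    obtain ⟨ξ, hξ, hslope⟩ := exists_hasDerivAt_eq_slope h h'
      (show t - (2 * M + 1) / h' t < t by linarith) hcont.continuousOn fun x _ => hd x
    have h1 := hanti hξ.2.le
    rw [hslope, sub_sub_cancel, le_div_iff₀ hpos, mul_div_cancel₀ _ ht.ne'] at h1
    have h2 := abs_le.1 (hM t)
    have h3 := abs_le.1 (hM (t - (2 * M + 1) / h' t))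
    linarith

/-- If all pairs of partial derivatives of a superharmonic function have proportional gradients,
then the function is concave in each coordinate wherever that partial derivative is nonzero. -/
lemma partialDeriv_partialDeriv_nonpos {u : 𝔼 → ℝ} (hu : ContDiff ℝ 2 u) {x : 𝔼}
    (hsuper : 0 ≤ -lap u x) (k : Fin N)
    (hprop : ∀ i, partialDeriv k u x • gradient (partialDeriv i u) x =
      partialDeriv i u x • gradient (partialDeriv k u) x) (hk : partialDeriv k u x ≠ 0) :
    partialDeriv k (partialDeriv k u) x ≤ 0 := by
  have hcomp (i j : Fin N) : partialDeriv k u x * partialDeriv j (partialDeriv i u) x =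
      partialDeriv i u x * partialDeriv j (partialDeriv k u) x := by
    have := congrArg (fun v => inner ℝ v (EuclideanSpace.single j (1 : ℝ))) (hprop i)
    simpa [inner_smul_left, inner_gradient_left, partialDeriv] using this
  have hdiag (i : Fin N) : partialDeriv k u x ^ 2 * partialDeriv i (partialDeriv i u) x =
      partialDeriv i u x ^ 2 * partialDeriv k (partialDeriv k u) x := by
    have h1 := hcomp i i
    have h2 := hcomp i k
    rw [partialDeriv_comm hu i k] at h1
    linear_combination partialDeriv k u x * h1 + partialDeriv i u x * h2
  have hsum : partialDeriv k u x ^ 2 * lap u x =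
      (∑ i, partialDeriv i u x ^ 2) * partialDeriv k (partialDeriv k u) x := by
    rw [lap_eq_sum hu, Finset.mul_sum, Finset.sum_mul]
    exact Finset.sum_congr rfl fun i _ => hdiag i
  have hpos : 0 < ∑ i, partialDeriv i u x ^ 2 :=
    Finset.sum_pos' (fun i _ => sq_nonneg _) ⟨k, Finset.mem_univ k, by positivity⟩
  by_contra! hlt
  nlinarith [mul_pos hpos hlt, mul_nonneg (sq_nonneg (partialDeriv k u x)) hsuper]

end Gradient

/-- Theorem 1.1: for `1 ≤ N ≤ 4`, `f ∈ C¹(ℝ)` with `f ≥ 0`, every bounded stable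
solution of `−Δu = f(u)` in `ℝ^N` is constant. -/
theorem stmt0 {N : ℕ} (hN1 : 1 ≤ N) (hN4 : N ≤ 4)
    (f : ℝ → ℝ) (hf : ContDiff ℝ 1 f) (hfnonneg : ∀ t : ℝ, 0 ≤ f t)
    (u : EuclideanSpace ℝ (Fin N) → ℝ) (hu : ContDiff ℝ 2 u)
    (hbd : ∃ M, ∀ x, |u x| ≤ M)
    (hsol : ∀ x, -lap u x = f (u x))
    (hstab : Stable (deriv f) u) :
    ∃ c : ℝ, ∀ x, u x = c := by
  obtain ⟨M, hM⟩ := hbd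
  obtain ⟨L, hL⟩ := exists_isCutoff N
  have hsuper (x) : 0 ≤ -lap u x := hsol x ▸ hfnonneg _
  obtain ⟨C, hC⟩ := exists_integral_norm_gradient_sq_mul_le hN4 hu hM hsuper hL
  have hlin (i : Fin N) := fun φ hφ hc => integral_inner_gradient_partialDeriv_eq (φ := φ) hf hu
    hsol hφ hc i
  have hprop (i k : Fin N) (x) : partialDeriv k u x • gradient (partialDeriv i u) x =
      partialDeriv i u x • gradient (partialDeriv k u) x :=
    smul_gradient_eq_smul_gradient ((hf.continuous_deriv le_rfl).comp hu.continuous)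
      (hu.of_le one_le_two) (contDiff_partialDeriv hu i) (contDiff_partialDeriv hu k)
      (abs_partialDeriv_le i u) (abs_partialDeriv_le k u) hL hC hstab (hlin i) (hlin k) x
  have hzero (k : Fin N) (x) : partialDeriv k u x = 0 := by
    set e : EuclideanSpace ℝ (Fin N) := EuclideanSpace.single k 1
    have hline (t : ℝ) : HasDerivAt (fun t : ℝ => x + t • e) e t := by
      simpa using ((hasDerivAt_id t).smul_const e).const_add x
    have key := deriv_eq_zero_of_bounded (h := fun t => u (x + t • e))
      (h' := fun t => partialDeriv k u (x + t • e))
      (h'' := fun t => partialDeriv k (partialDeriv k u) (x + t • e))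
      (fun t => (hu.differentiable two_ne_zero _).hasFDerivAt.comp_hasDerivAt t (hline t))
      (fun t => ((contDiff_partialDeriv hu k).differentiable one_ne_zero
        _).hasFDerivAt.comp_hasDerivAt t (hline t))
      ((continuous_partialDeriv (contDiff_partialDeriv hu k) k).comp (by fun_prop))
      (fun t => hM _)
      (fun t => partialDeriv_partialDeriv_nonpos hu (hsuper _) k fun i => hprop i k _) 0
    simpa using key
  refine ⟨u 0, fun x => is_const_of_fderiv_eq_zero (hu.differentiable two_ne_zero) (fun z => ?_)
    x 0⟩
  have hnorm : ‖gradient u z‖ ^ 2 = 0 := by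
    rw [← real_inner_self_eq_norm_sq, inner_gradient_eq_sum]
    exact Finset.sum_eq_zero fun i _ => mul_eq_zero_of_left (hzero i z) _
  have hgz : gradient u z = 0 := by simpa using hnorm
  rw [← toDual_gradient, hgz, map_zero]
end

section
/- Let f ∈ C⁰([0,∞)) ∩ C²((0,∞)) be convex and nondecreasing with f > 0 on (0,∞) and f(0) = 0, and suppose the limit q₀ = lim_{u→0⁺} q(u) exists in [0,+∞], where q(u) = f'(u)²/(f(u)f''(u)) (with q(u) = +∞ when f(u)f''(u) = 0). Then q₀ ∈ [1, +∞]. -/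
open MeasureTheory Filter Topology
open scoped ENNReal

/-- Lemma 1.4: if `f ∈ C⁰([0,∞)) ∩ C²((0,∞))` is convex nondecreasing, `f > 0` on `(0,∞)`,
`f(0) = 0` and `q₀ = lim_{u→0⁺} q(u)` exists in `[0,∞]`, then `q₀ ∈ [1,∞]`. -/
theorem stmt1 (f : ℝ → ℝ)
    (hcont : ContinuousOn f (Set.Ici 0)) (hC2 : ContDiffOn ℝ 2 f (Set.Ioi 0))
    (hconv : ConvexOn ℝ (Set.Ioi 0) f) (hmono : MonotoneOn f (Set.Ici 0))
    (hpos : ∀ t : ℝ, 0 < t → 0 < f t) (hf0 : f 0 = 0)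
    (q₀ : ℝ≥0∞) (hq : Tendsto (qfun f) (𝓝[>] (0:ℝ)) (𝓝 q₀)) :
    1 ≤ q₀ := by
  by_contra! hlt
  have hev : ∀ᶠ t in 𝓝[>] (0:ℝ), qfun f t < 1 := hq.eventually_lt_const hlt
  obtain ⟨b, hb, hsub⟩ := mem_nhdsGT_iff_exists_Ioo_subset.1 hev
  have hb0 : (0:ℝ) < b := hb
  have hdf : ∀ t : ℝ, 0 < t → HasDerivAt f (deriv f t) t := fun t ht =>
    ((hC2.differentiableOn (by norm_num)).differentiableAt (Ioi_mem_nhds ht)).hasDerivAt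
  have hddf : ∀ t : ℝ, 0 < t → HasDerivAt (deriv f) (deriv (deriv f) t) t := fun t ht =>
    (((hC2.deriv_of_isOpen (m := 1) isOpen_Ioi (by norm_num)).differentiableOn
      (by norm_num)).differentiableAt (Ioi_mem_nhds ht)).hasDerivAt
  have hmd : MonotoneOn (deriv f) (Set.Ioi 0) :=
    hconv.monotoneOn_deriv fun t ht => (hdf t ht).differentiableAt
  have hdd : ∀ t : ℝ, 0 < t → 0 ≤ deriv (deriv f) t := fun t ht => by
    rw [← derivWithin_of_isOpen isOpen_Ioi (Set.mem_Ioi.2 ht)]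
    exact hmd.derivWithin_nonneg
  have hsq : ∀ t ∈ Set.Ioo 0 b, deriv f t ^ 2 ≤ f t * deriv (deriv f) t := fun t ht => by
    have h : qfun f t < 1 := hsub ht
    unfold qfun at h
    split_ifs at h with h0
    · simp at h
    · have hp : 0 < f t * deriv (deriv f) t :=
        lt_of_le_of_ne (mul_nonneg (hpos t ht.1).le (hdd t ht.1)) (Ne.symm h0)
      rw [ENNReal.ofReal_lt_one, div_lt_one hp] at h
      exact h.le
  have hquot : ∀ t ∈ Set.Ioo 0 b, HasDerivAt (fun x => deriv f x / f x)
      ((deriv (deriv f) t * f t - deriv f t * deriv f t) / f t ^ 2) t := fun t ht =>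
    (hddf t ht.1).div (hdf t ht.1) (hpos t ht.1).ne'
  have hlog : MonotoneOn (fun x => deriv f x / f x) (Set.Ioo 0 b) := by
    refine monotoneOn_of_deriv_nonneg (convex_Ioo 0 b)
      (fun t ht => (hquot t ht).continuousAt.continuousWithinAt) ?_ ?_
    · rw [interior_Ioo]
      exact fun t ht => (hquot t ht).differentiableAt.differentiableWithinAt
    · rw [interior_Ioo]
      intro t ht
      rw [(hquot t ht).deriv]
      have := hsq t ht
      exact div_nonneg (by nlinarith) (sq_nonneg _)
  have hs : b / 2 ∈ Set.Ioo 0 b := ⟨by linarith, by linarith⟩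
  set s := b / 2
  set M := deriv f s / f s
  have hexp : ∀ t : ℝ, 0 < t → HasDerivAt (fun x => f x * Real.exp (-M * x))
      (deriv f t * Real.exp (-M * t) + f t * (Real.exp (-M * t) * (-M * 1))) t := fun t ht =>
    (hdf t ht).mul (((hasDerivAt_id t).const_mul (-M)).exp)
  have hanti : AntitoneOn (fun x => f x * Real.exp (-M * x)) (Set.Icc 0 s) := by
    refine antitoneOn_of_deriv_nonpos (convex_Icc 0 s)
      ((hcont.mono Set.Icc_subset_Ici_self).mul (by fun_prop)) ?_ ?_
    · rw [interior_Icc]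
      exact fun t ht => (hexp t ht.1).differentiableAt.differentiableWithinAt
    · rw [interior_Icc]
      intro t ht
      rw [(hexp t ht.1).deriv]
      have h : deriv f t / f t ≤ M := hlog ⟨ht.1, ht.2.trans hs.2⟩ hs ht.2.le
      rw [div_le_iff₀ (hpos t ht.1)] at h
      nlinarith [Real.exp_pos (-M * t)]
  have hle := hanti (Set.left_mem_Icc.2 hs.1.le) (Set.right_mem_Icc.2 hs.1.le) hs.1.le
  simp only [hf0, zero_mul] at hle
  exact absurd hle (not_le.2 (mul_pos (hpos s hs.1) (Real.exp_pos _)))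
end

section
/- Let f ∈ C⁰([0,∞)) ∩ C²((0,∞)) be nondecreasing and convex with f > 0 on (0,∞), and assume the limit q₀ = lim_{u→0⁺} q(u) exists; let p₀ be its conjugate exponent (1/p₀ + 1/q₀ = 1). Let u ∈ C²(ℝ^N) be a bounded, nonnegative, stable solution of −Δu = f(u) in ℝ^N. Then u ≡ 0 if either (1) 1 ≤ N ≤ 9, or (2) N = 10 and p₀ < +∞, or (3) N ≥ 11 and p₀ < p_c(N). -/
open MeasureTheory Filter Topology
open scoped ENNReal

/-! ### The strong maximum principle -/

section MaximumPrinciple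

variable {N : ℕ}

local notation "𝔼" => EuclideanSpace ℝ (Fin N)

lemma hasDerivAt_comp_line {u : 𝔼 → ℝ} (hu : Differentiable ℝ u) (x e : 𝔼) (t : ℝ) :
    HasDerivAt (fun t : ℝ => u (x + t • e)) (fderiv ℝ u (x + t • e) e) t := by
  have h : HasDerivAt (fun t : ℝ => x + t • e) e t := by
    simpa using ((hasDerivAt_id t).smul_const e).const_add x
  exact (hu _).hasFDerivAt.comp_hasDerivAt t h

lemma hasDerivAt_deriv_comp_line {u : 𝔼 → ℝ} (hu : ContDiff ℝ 2 u) (x e : 𝔼) :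
    HasDerivAt (deriv fun t : ℝ => u (x + t • e)) (iteratedFDeriv ℝ 2 u x ![e, e]) 0 := by
  have hd : (deriv fun t : ℝ => u (x + t • e)) = fun t : ℝ => fderiv ℝ u (x + t • e) e :=
    funext fun t => (hasDerivAt_comp_line (hu.differentiable (by norm_num)) x e t).deriv
  rw [hd, iteratedFDeriv_two_apply]
  have h : HasDerivAt (fun t : ℝ => x + t • e) e 0 := by
    simpa using ((hasDerivAt_id (0 : ℝ)).smul_const e).const_add x
  have h2 : HasFDerivAt (fderiv ℝ u) (fderiv ℝ (fderiv ℝ u) x) (x + (0 : ℝ) • e) := by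
    simpa using ((hu.fderiv_right (m := 1) (by norm_num)).differentiable
      (by norm_num) x).hasFDerivAt
  exact (ContinuousLinearMap.apply ℝ ℝ e).hasFDerivAt.comp_hasDerivAt (0 : ℝ)
    (h2.comp_hasDerivAt (0 : ℝ) h)

lemma deriv_deriv_nonneg_of_isLocalMin {g : ℝ → ℝ} {a : ℝ} (h : IsLocalMin g a)
    (hc : ContinuousAt g a) : 0 ≤ deriv (deriv g) a := by
  by_contra! hneg
  have hmax := isLocalMax_of_deriv_deriv_neg hneg h.deriv_eq_zero hc
  have heq : g =ᶠ[𝓝 a] fun _ => g a := by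
    filter_upwards [h, hmax] with t h1 h2 using le_antisymm h2 h1
  have h2 : deriv g =ᶠ[𝓝 a] fun _ => 0 := by
    filter_upwards [heq.eventuallyEq_nhds] with t ht
    rw [ht.deriv_eq]; simp
  rw [h2.deriv_eq] at hneg
  simp at hneg

lemma lap_nonneg_of_isLocalMin {w : 𝔼 → ℝ} (hw : ContDiff ℝ 2 w) {x : 𝔼}
    (h : IsLocalMin w x) : 0 ≤ lap w x := by
  refine Finset.sum_nonneg fun i _ => ?_
  rw [← (hasDerivAt_deriv_comp_line hw x (EuclideanSpace.single i 1)).deriv]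
  have hcont : Continuous fun t : ℝ => x + t • (EuclideanSpace.single i 1 : 𝔼) := by fun_prop
  refine deriv_deriv_nonneg_of_isLocalMin ?_ (hw.continuous.comp hcont).continuousAt
  have h0 : Tendsto (fun t : ℝ => x + t • (EuclideanSpace.single i 1 : 𝔼)) (𝓝 0) (𝓝 x) := by
    simpa using hcont.tendsto 0
  simpa [IsLocalMin, IsMinFilter] using h0.eventually h

lemma lap_add_const_mul {u v : 𝔼 → ℝ} (hu : ContDiff ℝ 2 u) (hv : ContDiff ℝ 2 v) (c : ℝ)
    (x : 𝔼) : lap (fun x => u x + c * v x) x = lap u x + c * lap v x := by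
  unfold lap
  rw [Finset.mul_sum, ← Finset.sum_add_distrib]
  refine Finset.sum_congr rfl fun i _ => ?_
  set e : 𝔼 := EuclideanSpace.single i 1
  have h1 := hasDerivAt_deriv_comp_line (hu.add (contDiff_const (c := c) |>.mul hv)) x e
  have h2 := (hasDerivAt_deriv_comp_line hu x e).add
    ((hasDerivAt_deriv_comp_line hv x e).const_mul c)
  refine h1.unique (h2.congr_of_eventuallyEq (Eventually.of_forall fun t => ?_))
  have du := hasDerivAt_comp_line (hu.differentiable (by norm_num)) x e t
  have dv := hasDerivAt_comp_line (hv.differentiable (by norm_num)) x e t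
  simp only [Pi.add_apply, du.deriv, dv.deriv]
  exact (du.add (dv.const_mul c)).deriv

lemma norm_add_smul_single_sub_sq (x y : 𝔼) (i : Fin N) (t : ℝ) :
    ‖x + t • (EuclideanSpace.single i 1 : 𝔼) - y‖ ^ 2
      = ‖x - y‖ ^ 2 + 2 * t * (x - y) i + t ^ 2 := by
  rw [add_sub_right_comm, norm_add_sq_real]
  simp [inner_smul_right, norm_smul, EuclideanSpace.inner_single_right]
  ring

lemma lap_norm_sq (x : 𝔼) : lap (fun x : 𝔼 => ‖x‖ ^ 2) x = 2 * N := by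
  unfold lap
  rw [Finset.sum_congr rfl (g := fun _ => (2 : ℝ))]
  · simp [mul_comm]
  intro i _
  refine (hasDerivAt_deriv_comp_line (contDiff_norm_sq ℝ) x _).unique ?_
  have hd : (deriv fun t : ℝ => ‖x + t • (EuclideanSpace.single i 1 : 𝔼)‖ ^ 2)
      = fun t => 2 * x i + 2 * t := by
    funext t
    have h1 : (fun t : ℝ => ‖x + t • (EuclideanSpace.single i 1 : 𝔼)‖ ^ 2)
        = fun t => ‖x‖ ^ 2 + 2 * t * x i + t ^ 2 := by
      funext t
      simpa using norm_add_smul_single_sub_sq x 0 i t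
    rw [h1]
    have := ((((hasDerivAt_id t).const_mul 2).mul_const (x i)).const_add (‖x‖ ^ 2)).add
      ((hasDerivAt_id t).pow 2)
    refine (this.congr_deriv ?_).deriv
    simp
  rw [hd]
  simpa using ((hasDerivAt_id (0 : ℝ)).const_mul 2).const_add (2 * x i)

lemma contDiff_gaussian (γ : ℝ) (y : 𝔼) :
    ContDiff ℝ 2 fun x : 𝔼 => Real.exp (-γ * ‖x - y‖ ^ 2) :=
  Real.contDiff_exp.comp (contDiff_const.mul ((contDiff_id.sub contDiff_const).norm_sq ℝ))

lemma lap_gaussian (γ : ℝ) (y x : 𝔼) :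
    lap (fun x : 𝔼 => Real.exp (-γ * ‖x - y‖ ^ 2)) x
      = Real.exp (-γ * ‖x - y‖ ^ 2) * (4 * γ ^ 2 * ‖x - y‖ ^ 2 - 2 * γ * N) := by
  have hsum : (4 * γ ^ 2 * ‖x - y‖ ^ 2 - 2 * γ * N)
      = ∑ i : Fin N, (4 * γ ^ 2 * ((x - y) i) ^ 2 - 2 * γ) := by
    rw [EuclideanSpace.norm_sq_eq, Finset.sum_sub_distrib, Finset.mul_sum]
    simp
    ring
  unfold lap
  rw [hsum, Finset.mul_sum]
  refine Finset.sum_congr rfl fun i _ => ?_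
  refine (hasDerivAt_deriv_comp_line (contDiff_gaussian γ y) x _).unique ?_
  have hpoly : ∀ t : ℝ, HasDerivAt
      (fun t : ℝ => -γ * (‖x - y‖ ^ 2 + 2 * t * (x - y) i + t ^ 2))
      (-γ * (2 * (x - y) i + 2 * t)) t := by
    intro t
    have := (((((hasDerivAt_id t).const_mul 2).mul_const ((x - y) i)).const_add
      (‖x - y‖ ^ 2)).add ((hasDerivAt_id t).pow 2)).const_mul (-γ)
    refine this.congr_deriv ?_
    simp
  have hd : (deriv fun t : ℝ => Real.exp (-γ * ‖x + t • (EuclideanSpace.single i 1 : 𝔼) - y‖ ^ 2))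
      = fun t => Real.exp (-γ * (‖x - y‖ ^ 2 + 2 * t * (x - y) i + t ^ 2))
        * (-γ * (2 * (x - y) i + 2 * t)) := by
    funext t
    simp only [norm_add_smul_single_sub_sq]
    exact (hpoly t).exp.deriv
  rw [hd]
  have hlin : HasDerivAt (fun t : ℝ => -γ * (2 * (x - y) i + 2 * t)) (-γ * 2) 0 := by
    simpa using (((hasDerivAt_id (0 : ℝ)).const_mul 2).const_add (2 * (x - y) i)).const_mul (-γ)
  refine ((hpoly 0).exp.mul hlin).congr_deriv ?_
  simp
  ring

/-- Strong maximum principle: a nonnegative superharmonic function vanishing at one point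
vanishes identically. -/
lemma eq_zero_of_lap_nonpos_of_eq_zero {u : 𝔼 → ℝ} (hu : ContDiff ℝ 2 u)
    (hnonneg : ∀ x, 0 ≤ u x) (hlap : ∀ x, lap u x ≤ 0) {z₀ : 𝔼} (hz₀ : u z₀ = 0) (y : 𝔼) :
    u y = 0 := by
  by_contra hy
  have hcl : IsClosed {x | u x = 0} := isClosed_eq hu.continuous continuous_const
  obtain ⟨z, hz, hRz⟩ := hcl.exists_infDist_eq_dist ⟨z₀, hz₀⟩ y
  set R := dist y z with hR
  have hRpos : 0 < R := dist_pos.2 fun h => hy (h ▸ hz)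
  have hin : ∀ x, dist x y < R → 0 < u x := by
    intro x hx
    refine lt_of_le_of_ne (hnonneg x) fun h0 => ?_
    have : R ≤ dist y x := hRz ▸ Metric.infDist_le_dist_of_mem (s := {x | u x = 0}) h0.symm
    rw [dist_comm] at this
    linarith
  obtain ⟨x₁, hx₁, hmin₁⟩ := (isCompact_closedBall y (R / 2)).exists_isMinOn
    ⟨y, Metric.mem_closedBall_self (by positivity)⟩ hu.continuous.continuousOn
  set ε := u x₁
  have hε : 0 < ε := hin x₁ (lt_of_le_of_lt hx₁ (by linarith))
  set γ : ℝ := (2 * N + 1) / R ^ 2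
  have hγ : 0 < γ := by positivity
  have hγR : γ * R ^ 2 = 2 * N + 1 := by simp only [γ]; field_simp
  set G : 𝔼 → ℝ := fun x => Real.exp (-γ * ‖x - y‖ ^ 2)
  have hG : ContDiff ℝ 2 G := contDiff_gaussian γ y
  set c := Real.exp (-γ * R ^ 2)
  set w : 𝔼 → ℝ := fun x => u x + (-ε) * G x
  have hw : ContDiff ℝ 2 w := hu.add (contDiff_const.mul hG)
  have hA : IsCompact (Metric.closedBall y R ∩ {x | R / 2 ≤ dist x y}) :=
    (isCompact_closedBall y R).inter_right
      (isClosed_le continuous_const (continuous_id.dist continuous_const))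
  have hwA : ∀ x ∈ Metric.closedBall y R ∩ {x | R / 2 ≤ dist x y}, -ε * c ≤ w x := by
    obtain ⟨p, ⟨hp1, hp2⟩, hpmin⟩ := hA.exists_isMinOn
      ⟨z, by simp [R, dist_comm], by simp [dist_comm z y, ← hR]; linarith⟩
      hw.continuous.continuousOn
    intro x hx
    refine le_trans ?_ (hpmin hx)
    by_contra! hlt
    rw [Metric.mem_closedBall] at hp1
    rw [Set.mem_ofPred_eq] at hp2
    have hp1' : dist p y ≠ R := by
      intro h
      have : G p = c := by simp only [G, c]; rw [← dist_eq_norm, h]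
      simp only [w, this] at hlt
      linarith [hnonneg p]
    have hp2' : R / 2 ≠ dist p y := by
      intro h
      have h1 : ε ≤ u p := hmin₁ (by rw [Metric.mem_closedBall, ← h])
      have h2 : G p ≤ 1 := Real.exp_le_one_iff.2 (by nlinarith [sq_nonneg ‖p - y‖])
      have h3 : 0 < c := Real.exp_pos _
      simp only [w] at hlt
      nlinarith
    have hloc : IsLocalMin w p := by
      have hopen : IsOpen {x : 𝔼 | R / 2 < dist x y ∧ dist x y < R} :=
        (isOpen_lt continuous_const (continuous_id.dist continuous_const)).inter
          (isOpen_lt (continuous_id.dist continuous_const) continuous_const)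
      filter_upwards [hopen.mem_nhds ⟨lt_of_le_of_ne hp2 hp2', lt_of_le_of_ne hp1 hp1'⟩]
        with x hx
      exact hpmin ⟨hx.2.le, hx.1.le⟩
    have h0 := lap_nonneg_of_isLocalMin hw hloc
    rw [lap_add_const_mul hu hG, lap_gaussian] at h0
    have hr : R ^ 2 / 4 ≤ ‖p - y‖ ^ 2 := by
      rw [← dist_eq_norm]; nlinarith
    have hpos : 0 < 4 * γ ^ 2 * ‖p - y‖ ^ 2 - 2 * γ * N := by
      have : γ ^ 2 * R ^ 2 ≤ 4 * γ ^ 2 * ‖p - y‖ ^ 2 := by nlinarith [sq_nonneg γ]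
      have h5 : γ ^ 2 * R ^ 2 = γ * (2 * N + 1) := by rw [← hγR]; ring
      nlinarith
    have := mul_pos hε (mul_pos (Real.exp_pos (-γ * ‖p - y‖ ^ 2)) hpos)
    linarith [hlap p]
  have hline : ∀ t ∈ Set.Icc (0 : ℝ) (1 / 2), -ε * c ≤ w (z + t • (y - z)) := by
    intro t ht
    have : dist (z + t • (y - z)) y = (1 - t) * R := by
      rw [dist_eq_norm, hR, dist_comm, dist_eq_norm,
        show z + t • (y - z) - y = (1 - t) • (z - y) by module, norm_smul, Real.norm_eq_abs,
        abs_of_nonneg (by linarith [ht.2])]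
    refine hwA _ ⟨?_, ?_⟩
    · rw [Metric.mem_closedBall, this]; nlinarith [ht.1]
    · rw [Set.mem_ofPred_eq, this]; nlinarith [ht.2]
  have hfu : fderiv ℝ u z = 0 := by
    refine IsLocalMin.fderiv_eq_zero (Eventually.of_forall fun x => ?_)
    rw [show u z = 0 from hz]
    exact hnonneg x
  have hdu : HasDerivAt (fun t : ℝ => u (z + t • (y - z))) 0 0 := by
    simpa [hfu] using hasDerivAt_comp_line (hu.differentiable (by norm_num)) z (y - z) 0
  have hdG : HasDerivAt (fun t : ℝ => G (z + t • (y - z))) (c * (2 * γ * R ^ 2)) 0 := by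
    have h1 : (fun t : ℝ => G (z + t • (y - z)))
        = fun t => Real.exp (-γ * ((1 - t) ^ 2 * R ^ 2)) := by
      funext t
      simp only [G]
      rw [show z + t • (y - z) - y = (1 - t) • (z - y) by module, norm_smul, mul_pow,
        Real.norm_eq_abs, sq_abs, hR, dist_comm, dist_eq_norm]
    rw [h1]
    have h2 := ((((((hasDerivAt_id (0 : ℝ)).const_sub 1).pow 2).mul_const (R ^ 2)).const_mul
      (-γ))).exp
    refine h2.congr_deriv ?_
    simp [c]
    ring
  have hdw : HasDerivAt (fun t : ℝ => w (z + t • (y - z))) (-ε * (c * (2 * γ * R ^ 2))) 0 := by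
    exact (hdu.add (hdG.const_mul (-ε))).congr_deriv (zero_add _)
  have hneg : -ε * (c * (2 * γ * R ^ 2)) < 0 := by
    have : 0 < ε * (c * (2 * γ * R ^ 2)) := by positivity
    linarith
  have hw0 : w (z + (0 : ℝ) • (y - z)) = -ε * c := by
    simp only [w, G, c, zero_smul, add_zero, show u z = 0 from hz]
    rw [hR, dist_comm, dist_eq_norm, zero_add]
  have hmono : IsLocalMinOn (fun t : ℝ => w (z + t • (y - z))) (Set.Icc 0 (1 / 2)) 0 := by
    filter_upwards [self_mem_nhdsWithin] with t ht
    rw [hw0]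
    exact hline t ht
  have h1 := hmono.hasFDerivWithinAt_nonneg (y := (1 / 2 : ℝ))
    hdw.hasFDerivAt.hasFDerivWithinAt
    (mem_posTangentConeAt_of_segment_subset (by
      rw [zero_add, segment_eq_Icc (by norm_num)]))
  simp at h1
  nlinarith

end MaximumPrinciple

/-! ### Test functions and the weak formulation -/

section WeakForm

variable {N : ℕ}

local notation "𝔼" => EuclideanSpace ℝ (Fin N)

lemma hasCompactSupport_gradient {φ : 𝔼 → ℝ} (hφ : HasCompactSupport φ) :
    HasCompactSupport (gradient φ) :=
  (hφ.fderiv (𝕜 := ℝ)).comp_left (g := (InnerProductSpace.toDual ℝ 𝔼).symm) (map_zero _)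

lemma integrable_mul_sq {A η : 𝔼 → ℝ} (hA : Continuous A) (hη : Continuous η)
    (hηc : HasCompactSupport η) : Integrable fun x => A x * η x ^ 2 :=
  (hA.mul (hη.pow 2)).integrable_of_hasCompactSupport <|
    hηc.mono fun x hx => by
      contrapose! hx
      simp only [Function.mem_support, not_not] at hx ⊢
      simp [hx]

lemma integrable_mul_norm_gradient_sq {A η : 𝔼 → ℝ} (hA : Continuous A) (hη : ContDiff ℝ 1 η)
    (hηc : HasCompactSupport η) : Integrable fun x => A x * ‖gradient η x‖ ^ 2 :=
  (hA.mul ((continuous_gradient hη).norm.pow 2)).integrable_of_hasCompactSupport <|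
    (hasCompactSupport_gradient hηc).mono fun x hx => by
      contrapose! hx
      simp only [Function.mem_support, not_not] at hx ⊢
      simp [hx]

lemma integral_inner_gradient {u g φ : 𝔼 → ℝ} (hu : ContDiff ℝ 2 u)
    (hsol : ∀ x, -lap u x = g x) (hφ : ContDiff ℝ 1 φ) (hφc : HasCompactSupport φ) :
    ∫ x, inner ℝ (gradient u x) (gradient φ x) = ∫ x, g x * φ x := by
  have hu1 : ContDiff ℝ 1 (fderiv ℝ u) := hu.fderiv_right (by norm_num)
  have hsum : ∀ x, inner ℝ (gradient u x) (gradient φ x)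
      = ∑ i : Fin N, fderiv ℝ u x (EuclideanSpace.single i 1)
        * fderiv ℝ φ x (EuclideanSpace.single i 1) := by
    intro x
    rw [← (EuclideanSpace.basisFun (Fin N) ℝ).sum_inner_mul_inner]
    refine Finset.sum_congr rfl fun i _ => ?_
    rw [inner_gradient_left, real_inner_comm, inner_gradient_left]
    simp
  have hsum2 : ∀ x, g x * φ x = ∑ i : Fin N,
      -(fderiv ℝ (fun x => fderiv ℝ u x (EuclideanSpace.single i 1)) x
        (EuclideanSpace.single i 1) * φ x) := by
    intro x
    rw [← hsol x, lap, Finset.sum_neg_distrib, ← Finset.sum_mul, neg_mul]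
    refine congrArg (fun r => -(r * φ x)) (Finset.sum_congr rfl fun i _ => ?_)
    rw [iteratedFDeriv_two_apply]
    rw [fderiv_clm_apply (hu1.differentiable (by norm_num) x) (by fun_prop)]
    simp
  have hv : ∀ v : 𝔼, ContDiff ℝ 1 fun x => fderiv ℝ u x v := fun v => hu1.clm_apply contDiff_const
  have hi1 : ∀ v : 𝔼, Integrable fun x => fderiv ℝ u x v * fderiv ℝ φ x v := fun v =>
    ((hv v).continuous.mul ((hφ.continuous_fderiv (by norm_num)).clm_apply
      continuous_const)).integrable_of_hasCompactSupport (hφc.fderiv_apply ℝ v).mul_left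
  have hi2 : ∀ v : 𝔼, Integrable fun x => fderiv ℝ (fun x => fderiv ℝ u x v) x v * φ x :=
    fun v => ((((hv v).continuous_fderiv (by norm_num)).clm_apply continuous_const).mul
      hφ.continuous).integrable_of_hasCompactSupport hφc.mul_left
  simp_rw [hsum, hsum2]
  rw [integral_finsetSum _ fun i _ => hi1 _, integral_finsetSum]
  swap
  · exact fun i _ => (hi2 _).neg
  refine Finset.sum_congr rfl fun i _ => ?_
  rw [integral_neg]
  exact integral_mul_fderiv_eq_neg_fderiv_mul_of_integrable (hi2 _) (hi1 _)
    (((hv _).continuous.mul hφ.continuous).integrable_of_hasCompactSupport hφc.mul_left)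
    (fun x _ => (hv _).differentiable (by norm_num) x)
    (fun x _ => hφ.differentiable (by norm_num) x)

lemma contDiff_comp_mul {u η : 𝔼 → ℝ} {G : ℝ → ℝ} (hu : ContDiff ℝ 1 u) (hpos : ∀ x, 0 < u x)
    (hG : ContDiffOn ℝ 1 G (Set.Ioi 0)) (hη : ContDiff ℝ 1 η) :
    ContDiff ℝ 1 fun x => G (u x) * η x :=
  (hG.comp_contDiff hu hpos).mul hη

lemma gradient_comp_mul {u η : 𝔼 → ℝ} {G : ℝ → ℝ} (hu : ContDiff ℝ 1 u) (hpos : ∀ x, 0 < u x)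
    (hG : ContDiffOn ℝ 1 G (Set.Ioi 0)) (hη : ContDiff ℝ 1 η) (x : 𝔼) :
    gradient (fun x => G (u x) * η x) x
      = (deriv G (u x) * η x) • gradient u x + G (u x) • gradient η x := by
  have hGd : HasDerivAt G (deriv G (u x)) (u x) :=
    ((hG.differentiableOn (by norm_num)).differentiableAt (Ioi_mem_nhds (hpos x))).hasDerivAt
  have h := (hGd.comp_hasFDerivAt x (hu.differentiable (by norm_num) x).hasFDerivAt).mul
    (hη.differentiable (by norm_num) x).hasFDerivAt
  have h' : fderiv ℝ (fun x => G (u x) * η x) x = _ := h.fderiv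
  rw [gradient, h', map_add, map_smul, map_smul, map_smul, gradient, gradient, smul_smul, add_comm,
    mul_comm (η x)]
  rfl

lemma gradient_sq {η : 𝔼 → ℝ} (hη : ContDiff ℝ 1 η) (x : 𝔼) :
    gradient (fun x => η x ^ 2) x = (2 * η x) • gradient η x := by
  have h' := ((hη.differentiable (by norm_num) x).hasFDerivAt.pow 2).fderiv
  have h : fderiv ℝ (fun x => η x ^ 2) x = _ := h'
  rw [gradient, h]
  simp [gradient]

/-- The combination of the stability inequality tested with `ψ(u) η` and of the equation tested
with `K(u) η²`. -/
lemma integral_le_of_stable {u A B η : 𝔼 → ℝ} {f ψ K : ℝ → ℝ} {μ : ℝ} (hu : ContDiff ℝ 2 u)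
    (hpos : ∀ x, 0 < u x) (hf : ContinuousOn f (Set.Ioi 0))
    (hf' : ContinuousOn (deriv f) (Set.Ioi 0)) (hsol : ∀ x, -lap u x = f (u x))
    (hstab : Stable (deriv f) u)
    (hψ : ContDiffOn ℝ 1 ψ (Set.Ioi 0)) (hK : ContDiffOn ℝ 1 K (Set.Ioi 0)) (hμ : 1 < μ)
    (hK' : ∀ x, deriv ψ (u x) ^ 2 ≤ deriv K (u x)) (hK0 : ∀ x, 0 ≤ K (u x))
    (hKψ : ∀ x, K (u x) ≤ ψ (u x) * deriv ψ (u x))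
    (hAc : Continuous A) (hBc : Continuous B)
    (hA : ∀ x, A x ≤ deriv f (u x) * ψ (u x) ^ 2 - μ * (f (u x) * K (u x)))
    (hB : ∀ x, ψ (u x) ^ 2 ≤ B x) (hη : ContDiff ℝ 1 η) (hηc : HasCompactSupport η) :
    ∫ x, A x * η x ^ 2 ≤ ((1 + μ) ^ 2 / (μ - 1) + 1) * ∫ x, B x * ‖gradient η x‖ ^ 2 := by
  have hu1 : ContDiff ℝ 1 u := hu.of_le (by norm_num)
  set κ := (1 + μ) ^ 2 / (μ - 1) + 1 with hκ
  set φ : 𝔼 → ℝ := fun x => ψ (u x) * η x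
  set χ : 𝔼 → ℝ := fun x => K (u x) * η x ^ 2
  have hφ : ContDiff ℝ 1 φ := contDiff_comp_mul hu1 hpos hψ hη
  have hχ : ContDiff ℝ 1 χ := contDiff_comp_mul hu1 hpos hK (hη.pow 2)
  have hφc : HasCompactSupport φ := hηc.mul_left
  have hχc : HasCompactSupport χ := hηc.mono fun x hx => by
    contrapose! hx
    simp only [Function.mem_support, not_not, χ] at hx ⊢
    simp [hx]
  have hst := hstab φ hφ hφc
  have heq := integral_inner_gradient hu hsol hχ hχc
  have hfu : Continuous fun x => f (u x) := hf.comp_continuous hu.continuous hpos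
  have hfu' : Continuous fun x => deriv f (u x) := hf'.comp_continuous hu.continuous hpos
  have i1 : Integrable fun x => deriv f (u x) * φ x ^ 2 := integrable_mul_sq hfu' hφ.continuous hφc
  have i2 : Integrable fun x => ‖gradient φ x‖ ^ 2 := by
    simpa using integrable_mul_norm_gradient_sq (continuous_const (y := (1 : ℝ))) hφ hφc
  have i3 : Integrable fun x => inner ℝ (gradient u x) (gradient χ x) :=
    ((continuous_gradient hu1).inner (continuous_gradient hχ)).integrable_of_hasCompactSupport <|
      (hasCompactSupport_gradient hχc).mono fun x hx => by
        contrapose! hx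
        simp only [Function.mem_support, not_not] at hx ⊢
        simp [hx]
  have i4 : Integrable fun x => f (u x) * χ x :=
    (hfu.mul hχ.continuous).integrable_of_hasCompactSupport hχc.mul_left
  have i5 := integrable_mul_sq hAc hη.continuous hηc
  have i6 := (integrable_mul_norm_gradient_sq hBc hη hηc).const_mul κ
  have key : ∀ x, (‖gradient φ x‖ ^ 2 - deriv f (u x) * φ x ^ 2)
      + μ * (f (u x) * χ x - inner ℝ (gradient u x) (gradient χ x))
      ≤ κ * (B x * ‖gradient η x‖ ^ 2) - A x * η x ^ 2 := by
    intro x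
    have e1 : gradient φ x = _ := gradient_comp_mul hu1 hpos hψ hη x
    have e2 : gradient χ x = _ := gradient_comp_mul hu1 hpos hK (hη.pow 2) x
    rw [gradient_sq hη] at e2
    rw [e1, e2, norm_add_sq_real]
    simp only [inner_add_right, inner_smul_left, inner_smul_right, norm_smul, mul_pow,
      real_inner_self_eq_norm_sq, φ, χ, Real.norm_eq_abs, sq_abs, RCLike.conj_to_real]
    set I := inner ℝ (gradient u x) (gradient η x)
    set U := ‖gradient u x‖
    set V := ‖gradient η x‖
    have hI : |I| ≤ U * V := abs_real_inner_le_norm _ _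
    have hψψ : 0 ≤ ψ (u x) * deriv ψ (u x) := (hK0 x).trans (hKψ x)
    set a := ψ (u x)
    set b := deriv ψ (u x)
    set k := K (u x)
    have c1 : |2 * (a * b - μ * k) * η x * I| ≤ 2 * (1 + μ) * (|b * η x| * U) * (|a| * V) := by
      have h1 : |a * b - μ * k| ≤ (1 + μ) * (a * b) := by
        rw [abs_le]; constructor <;> nlinarith [hK0 x, hKψ x]
      calc |2 * (a * b - μ * k) * η x * I| = 2 * |a * b - μ * k| * |η x| * |I| := by
            rw [abs_mul, abs_mul, abs_mul]; norm_num
        _ ≤ 2 * ((1 + μ) * (a * b)) * |η x| * (U * V) := by gcongr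
        _ = 2 * (1 + μ) * (|b * η x| * U) * (|a| * V) := by
            rw [← abs_of_nonneg hψψ, abs_mul, abs_mul]; ring
    have c2 : 2 * (1 + μ) * (|b * η x| * U) * (|a| * V)
        ≤ (μ - 1) * (|b * η x| * U) ^ 2 + (κ - 1) * (|a| * V) ^ 2 := by
      have h0 : 0 < μ - 1 := by linarith
      have hκ' : (κ - 1) * (μ - 1) = (1 + μ) ^ 2 := by rw [hκ, add_sub_cancel_right]; field_simp
      have h2 := sq_nonneg ((μ - 1) * (|b * η x| * U) - (1 + μ) * (|a| * V))
      refine le_of_mul_le_mul_left ?_ h0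
      have h3 : (μ - 1) * ((μ - 1) * (|b * η x| * U) ^ 2 + (κ - 1) * (|a| * V) ^ 2)
        = (μ - 1) ^ 2 * (|b * η x| * U) ^ 2 + ((κ - 1) * (μ - 1)) * (|a| * V) ^ 2 := by ring
      rw [h3, hκ']
      nlinarith
    have c3 : (|b * η x| * U) ^ 2 ≤ deriv K (u x) * (η x ^ 2 * U ^ 2) := by
      rw [mul_pow, sq_abs, mul_pow, mul_assoc]
      exact mul_le_mul_of_nonneg_right (hK' x) (by positivity)
    have c4 : κ * (|a| * V) ^ 2 ≤ κ * (B x * V ^ 2) := by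
      have : 0 ≤ κ := add_nonneg (div_nonneg (sq_nonneg _) (by linarith)) zero_le_one
      rw [mul_pow, sq_abs]
      exact mul_le_mul_of_nonneg_left (mul_le_mul_of_nonneg_right (hB x) (sq_nonneg _)) this
    have c5 := mul_le_mul_of_nonneg_right (hA x) (sq_nonneg (η x))
    have c6 := (le_abs_self _).trans (c1.trans c2)
    have c7 : (|b * η x| * U) ^ 2 = b ^ 2 * η x ^ 2 * U ^ 2 := by
      rw [mul_pow, sq_abs, mul_pow]
    have c8 : (|a| * V) ^ 2 = a ^ 2 * V ^ 2 := by rw [mul_pow, sq_abs]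
    have c9 := mul_le_mul_of_nonneg_left c3 (by linarith : 0 ≤ μ)
    rw [c8] at c4 c6
    rw [c7] at c6 c9
    linarith
  have hineq := integral_mono ((i2.sub i1).add ((i4.sub i3).const_mul μ)) (i6.sub i5) key
  have e1 : ∫ x, ((‖gradient φ x‖ ^ 2 - deriv f (u x) * φ x ^ 2)
      + μ * (f (u x) * χ x - inner ℝ (gradient u x) (gradient χ x)))
      = ((∫ x, ‖gradient φ x‖ ^ 2) - ∫ x, deriv f (u x) * φ x ^ 2)
        + μ * ((∫ x, f (u x) * χ x) - ∫ x, inner ℝ (gradient u x) (gradient χ x)) := by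
    rw [← integral_sub i2 i1, ← integral_sub i4 i3, ← integral_const_mul]
    exact integral_add (i2.sub i1) ((i4.sub i3).const_mul μ)
  have e2 : ∫ x, (κ * (B x * ‖gradient η x‖ ^ 2) - A x * η x ^ 2)
      = κ * (∫ x, B x * ‖gradient η x‖ ^ 2) - ∫ x, A x * η x ^ 2 := by
    rw [integral_sub i6 i5, integral_const_mul]
  have hineq' : ∫ x, ((‖gradient φ x‖ ^ 2 - deriv f (u x) * φ x ^ 2)
      + μ * (f (u x) * χ x - inner ℝ (gradient u x) (gradient χ x)))
      ≤ ∫ x, (κ * (B x * ‖gradient η x‖ ^ 2) - A x * η x ^ 2) := hineq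
  rw [e1, e2, heq, sub_self, mul_zero, add_zero] at hineq'
  linarith

/-- The equation tested with `κ(u) η²` for a decreasing function `κ`. -/
lemma integral_le_of_supersolution {u A B η : 𝔼 → ℝ} {f k : ℝ → ℝ} (hu : ContDiff ℝ 2 u)
    (hpos : ∀ x, 0 < u x) (hf : ContinuousOn f (Set.Ioi 0)) (hsol : ∀ x, -lap u x = f (u x))
    (hk : ContDiffOn ℝ 1 k (Set.Ioi 0)) (hk' : ∀ x, k (u x) ^ 2 ≤ B x * -deriv k (u x))
    (hAc : Continuous A) (hBc : Continuous B) (hB0 : ∀ x, 0 < B x)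
    (hA : ∀ x, A x ≤ f (u x) * k (u x)) (hη : ContDiff ℝ 1 η) (hηc : HasCompactSupport η) :
    ∫ x, A x * η x ^ 2 ≤ ∫ x, B x * ‖gradient η x‖ ^ 2 := by
  have hu1 : ContDiff ℝ 1 u := hu.of_le (by norm_num)
  set χ : 𝔼 → ℝ := fun x => k (u x) * η x ^ 2
  have hχ : ContDiff ℝ 1 χ := contDiff_comp_mul hu1 hpos hk (hη.pow 2)
  have hχc : HasCompactSupport χ := hηc.mono fun x hx => by
    contrapose! hx
    simp only [Function.mem_support, not_not, χ] at hx ⊢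
    simp [hx]
  have heq := integral_inner_gradient hu hsol hχ hχc
  have hfu : Continuous fun x => f (u x) := hf.comp_continuous hu.continuous hpos
  have i3 : Integrable fun x => inner ℝ (gradient u x) (gradient χ x) :=
    ((continuous_gradient hu1).inner (continuous_gradient hχ)).integrable_of_hasCompactSupport <|
      (hasCompactSupport_gradient hχc).mono fun x hx => by
        contrapose! hx
        simp only [Function.mem_support, not_not] at hx ⊢
        simp [hx]
  have i4 : Integrable fun x => f (u x) * χ x :=
    (hfu.mul hχ.continuous).integrable_of_hasCompactSupport hχc.mul_left
  have i5 := integrable_mul_sq hAc hη.continuous hηc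
  have i6 := integrable_mul_norm_gradient_sq hBc hη hηc
  have key : ∀ x, inner ℝ (gradient u x) (gradient χ x) - f (u x) * χ x
      ≤ B x * ‖gradient η x‖ ^ 2 - A x * η x ^ 2 := by
    intro x
    have e2 : gradient χ x = _ := gradient_comp_mul hu1 hpos hk (hη.pow 2) x
    rw [gradient_sq hη] at e2
    rw [e2]
    simp only [inner_add_right, inner_smul_right, real_inner_self_eq_norm_sq, χ]
    set I := inner ℝ (gradient u x) (gradient η x)
    set U := ‖gradient u x‖
    set V := ‖gradient η x‖
    have hI : |I| ≤ U * V := abs_real_inner_le_norm _ _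
    set d := -deriv k (u x) with hd
    have hd' : deriv k (u x) = -d := by rw [hd]; ring
    rw [hd']
    have c5 := mul_le_mul_of_nonneg_right (hA x) (sq_nonneg (η x))
    have c1 : k (u x) * (2 * η x * I) ≤ 2 * (|k (u x)| * (|η x| * U)) * V := by
      refine (le_abs_self _).trans ?_
      rw [abs_mul, abs_mul, abs_mul, abs_two]
      calc |k (u x)| * (2 * |η x| * |I|) ≤ |k (u x)| * (2 * |η x| * (U * V)) := by gcongr
        _ = _ := by ring
    have c2 : 2 * (|k (u x)| * (|η x| * U)) * V ≤ B x * V ^ 2 + d * (η x ^ 2 * U ^ 2) := by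
      refine le_of_mul_le_mul_left ?_ (hB0 x)
      have h1 := sq_nonneg (B x * V - |k (u x)| * (|η x| * U))
      have h2 : (|k (u x)| * (|η x| * U)) ^ 2 ≤ B x * d * (η x ^ 2 * U ^ 2) := by
        rw [mul_pow, mul_pow, sq_abs, sq_abs]
        exact mul_le_mul_of_nonneg_right (hk' x) (by positivity)
      nlinarith
    linarith
  have hineq : ∫ x, (inner ℝ (gradient u x) (gradient χ x) - f (u x) * χ x)
      ≤ ∫ x, (B x * ‖gradient η x‖ ^ 2 - A x * η x ^ 2) :=
    integral_mono (i3.sub i4) (i6.sub i5) key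
  rw [integral_sub i3 i4, integral_sub i6 i5, heq, sub_self] at hineq
  linarith

end WeakForm

/-! ### The scaling argument -/

section Scaling

variable {N : ℕ}

local notation "𝔼" => EuclideanSpace ℝ (Fin N)

lemma exists_scaled_cutoff (m : ℕ) : ∃ C : ℝ, 0 ≤ C ∧ ∃ ζ : 𝔼 → ℝ, Continuous ζ ∧
    (∀ x, 0 ≤ ζ x) ∧ (∀ x, ζ x ≤ 1) ∧ (∀ x, ‖x‖ ≤ 1 → ζ x = 1) ∧ (∀ x, 2 ≤ ‖x‖ → ζ x = 0) ∧
    ∀ R : ℝ, 0 < R → ContDiff ℝ 1 (fun x => ζ (R⁻¹ • x) ^ m) ∧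
      HasCompactSupport (fun x => ζ (R⁻¹ • x)) ∧
      ∀ x, ‖gradient (fun x => ζ (R⁻¹ • x) ^ m) x‖ ≤ C * R⁻¹ * ζ (R⁻¹ • x) ^ (m - 1) := by
  let ζ : ContDiffBump (0 : 𝔼) := ⟨1, 2, one_pos, one_lt_two⟩
  have hζ : ContDiff ℝ 1 ζ := ζ.contDiff
  obtain ⟨B, hB⟩ := (ζ.hasCompactSupport.fderiv (𝕜 := ℝ)).exists_bound_of_continuous
    (hζ.continuous_fderiv (by norm_num))
  have hB0 : 0 ≤ B := (norm_nonneg _).trans (hB 0)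
  refine ⟨m * B, by positivity, ζ, ζ.continuous, fun x => ζ.nonneg, fun x => ζ.le_one,
    fun x hx => ζ.one_of_mem_closedBall (by simpa using hx),
    fun x hx => ζ.zero_of_le_dist (by simpa using hx), fun R hR => ?_⟩
  have hlin : ContDiff ℝ 1 fun x : 𝔼 => R⁻¹ • x := contDiff_const_smul _
  refine ⟨(hζ.comp hlin).pow m, ζ.hasCompactSupport.comp_smul (inv_ne_zero hR.ne'), fun x => ?_⟩
  have h1 : HasFDerivAt (fun x : 𝔼 => R⁻¹ • x) (R⁻¹ • ContinuousLinearMap.id ℝ 𝔼) x :=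
    (R⁻¹ • ContinuousLinearMap.id ℝ 𝔼).hasFDerivAt
  have h2 := (((hζ.differentiable (by norm_num) (R⁻¹ • x)).hasFDerivAt.comp x h1).pow m).fderiv
  have h3 : fderiv ℝ (fun x => ζ (R⁻¹ • x) ^ m) x = _ := h2
  rw [gradient, LinearIsometryEquiv.norm_map, h3, norm_smul]
  have h4 : ‖(fderiv ℝ ζ (R⁻¹ • x)).comp (R⁻¹ • ContinuousLinearMap.id ℝ 𝔼)‖ ≤ B * R⁻¹ := by
    rw [ContinuousLinearMap.comp_smul, ContinuousLinearMap.comp_id, norm_smul, Real.norm_eq_abs,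
      abs_of_pos (inv_pos.2 hR), mul_comm]
    exact mul_le_mul_of_nonneg_right (hB _) (inv_pos.2 hR).le
  have h5 : ‖(m • (ζ ∘ fun x : 𝔼 => R⁻¹ • x) x ^ (m - 1))‖ = m * ζ (R⁻¹ • x) ^ (m - 1) := by
    rw [nsmul_eq_mul, Real.norm_eq_abs, abs_of_nonneg]
    · rfl
    · exact mul_nonneg (Nat.cast_nonneg _) (pow_nonneg ζ.nonneg _)
  rw [h5]
  calc _ ≤ m * ζ (R⁻¹ • x) ^ (m - 1) * (B * R⁻¹) :=
        mul_le_mul_of_nonneg_left h4 (mul_nonneg (Nat.cast_nonneg _) (pow_nonneg ζ.nonneg _))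
    _ = _ := by ring

lemma half_mul_rpow_mul_pow_le {w z L a s : ℝ} {m : ℕ} (hw : 0 ≤ w) (hz0 : 0 ≤ z) (hz1 : z ≤ 1)
    (ha : 0 < a) (hs : 0 < s) (hm : a + s ≤ m * s) (hL : 0 ≤ L) :
    L / 2 * (w ^ a * (z ^ (m - 1)) ^ 2)
      ≤ 1 / 2 * (w ^ (a + s) * (z ^ m) ^ 2) + 1 / 2 * L ^ ((a + s) / s) := by
  have hm1 : 1 ≤ m := by
    rcases Nat.eq_zero_or_pos m with h | h
    · rw [h] at hm; push_cast at hm; linarith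
    · exact h
  have hX : 0 ≤ w ^ a * (z ^ (m - 1)) ^ 2 := by positivity
  have hY : w ^ (a + s) * (z ^ m) ^ 2 = (w ^ s * z ^ 2) * (w ^ a * (z ^ (m - 1)) ^ 2) := by
    rw [Real.rpow_add_of_nonneg hw ha.le hs.le]
    obtain ⟨k, rfl⟩ : ∃ k, m = k + 1 := ⟨m - 1, by omega⟩
    simp only [Nat.add_sub_cancel]
    ring
  have hLp : 0 ≤ L ^ ((a + s) / s) := Real.rpow_nonneg hL _
  rcases le_total L (w ^ s * z ^ 2) with h | h
  · have := mul_le_mul_of_nonneg_right h hX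
    rw [← hY] at this
    linarith
  · have h1 : w ^ a * (z ^ (m - 1)) ^ 2 ≤ L ^ (a / s) := by
      refine le_trans ?_ (Real.rpow_le_rpow (by positivity) h (by positivity))
      rw [Real.mul_rpow (by positivity) (by positivity), ← Real.rpow_mul hw,
        mul_div_cancel₀ _ hs.ne']
      refine mul_le_mul_of_nonneg_left ?_ (by positivity)
      rw [← pow_mul, ← Real.rpow_natCast, ← Real.rpow_natCast, ← Real.rpow_mul hz0]
      have he : ((2 : ℕ) : ℝ) * (a / s) ≤ ((m - 1) * 2 : ℕ) := by
        push_cast [Nat.cast_sub hm1]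
        have : a / s ≤ m - 1 := by rw [div_le_iff₀ hs]; linarith
        linarith
      rcases eq_or_lt_of_le hz0 with h0 | h0
      · rw [← h0]
        rcases eq_or_lt_of_le hm1 with h1 | h1
        · exfalso
          rw [← h1] at hm; push_cast at hm; linarith
        · rw [Real.zero_rpow (by push_cast; have : 0 < m - 1 := by omega
                                 positivity), Real.zero_rpow (by positivity)]
      · exact Real.rpow_le_rpow_of_exponent_ge h0 hz1 he
    have h2 : L ^ ((a + s) / s) = L * L ^ (a / s) := by
      rw [add_div, div_self hs.ne', Real.rpow_add_of_nonneg hL (by positivity) zero_le_one,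
        Real.rpow_one, mul_comm]
    have h3 : 0 ≤ w ^ (a + s) * (z ^ m) ^ 2 := by positivity
    rw [h2]
    nlinarith [mul_le_mul_of_nonneg_left h1 hL]

lemma eq_zero_of_integral_le {w : 𝔼 → ℝ} (hw : Continuous w) (hw0 : ∀ x, 0 ≤ w x) {a s D : ℝ}
    (ha : 0 < a) (hs : 0 < s) (hD : 0 ≤ D) (hN : N < 2 * ((a + s) / s))
    (h : ∀ η : 𝔼 → ℝ, ContDiff ℝ 1 η → HasCompactSupport η →
      ∫ x, w x ^ (a + s) * η x ^ 2 ≤ D * ∫ x, w x ^ a * ‖gradient η x‖ ^ 2) (x₀ : 𝔼) :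
    w x₀ = 0 := by
  obtain ⟨m, hm⟩ := exists_nat_ge ((a + s) / s)
  have hms : a + s ≤ m * s := by rwa [div_le_iff₀ hs] at hm
  have hm2 : 1 < m := by
    have : (1 : ℝ) < m := by
      by_contra! h'
      nlinarith
    exact_mod_cast this
  obtain ⟨C, hC, ζ, hζc, hζ0, hζ1, hζone, hζzero, hζ⟩ := exists_scaled_cutoff (N := N) m
  set p := (a + s) / s
  set V : ℝ := volume.real (Metric.closedBall (0 : 𝔼) 1)
  set L₀ : ℝ := 2 * D * C ^ 2
  have hL₀ : 0 ≤ L₀ := by positivity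
  have hca : Continuous fun x => w x ^ a := hw.rpow_const fun _ => Or.inr ha.le
  have hcas : Continuous fun x => w x ^ (a + s) := hw.rpow_const fun _ => Or.inr (by positivity)
  have hest : ∀ R : ℝ, 0 < R → ∫ x, w x ^ (a + s) * (ζ (R⁻¹ • x) ^ m) ^ 2
      ≤ L₀ ^ p * 2 ^ N * V * R ^ ((N : ℝ) - 2 * p) := by
    intro R hR
    obtain ⟨hη, hcs, hgrad⟩ := hζ R hR
    set η : 𝔼 → ℝ := fun x => ζ (R⁻¹ • x) ^ m
    have hηc : HasCompactSupport η :=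
      hcs.comp_left (g := fun t : ℝ => t ^ m) (zero_pow (by omega))
    set L := L₀ * (R⁻¹) ^ 2
    have hL : 0 ≤ L := by positivity
    have hpt : ∀ x, D * (w x ^ a * ‖gradient η x‖ ^ 2) ≤ 1 / 2 * (w x ^ (a + s) * η x ^ 2)
        + (Metric.closedBall (0 : 𝔼) (2 * R)).indicator (fun _ => 1 / 2 * L ^ p) x := by
      intro x
      have hwa : 0 ≤ w x ^ a := Real.rpow_nonneg (hw0 x) _
      by_cases hx : x ∈ Metric.closedBall (0 : 𝔼) (2 * R)
      · rw [Set.indicator_of_mem hx]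
        refine le_trans ?_ (half_mul_rpow_mul_pow_le (hw0 x) (hζ0 (R⁻¹ • x)) (hζ1 _) ha hs hms hL)
        calc D * (w x ^ a * ‖gradient η x‖ ^ 2)
            ≤ D * (w x ^ a * (C * R⁻¹ * ζ (R⁻¹ • x) ^ (m - 1)) ^ 2) := by
              gcongr; exact hgrad x
          _ = _ := by simp only [L, L₀]; ring
      · have hz : ζ (R⁻¹ • x) = 0 := by
          refine hζzero _ ?_
          rw [mem_closedBall_zero_iff, not_le] at hx
          rw [norm_smul, Real.norm_eq_abs, abs_of_pos (inv_pos.2 hR), inv_mul_eq_div,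
            le_div_iff₀ hR]
          exact hx.le
        have hg : ‖gradient η x‖ = 0 := by
          refine le_antisymm ((hgrad x).trans ?_) (norm_nonneg _)
          rw [hz, zero_pow (by omega), mul_zero]
        rw [Set.indicator_of_notMem hx, hg]
        have : 0 ≤ w x ^ (a + s) := Real.rpow_nonneg (hw0 x) _
        simp only [ne_eq, OfNat.ofNat_ne_zero, not_false_eq_true, zero_pow, mul_zero, add_zero]
        positivity
    have i1 := (integrable_mul_norm_gradient_sq hca hη hηc).const_mul D
    have i2 := (integrable_mul_sq hcas hη.continuous hηc).const_mul (1 / 2)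
    have i3 : Integrable ((Metric.closedBall (0 : 𝔼) (2 * R)).indicator
        fun _ => 1 / 2 * L ^ p) :=
      (integrable_indicator_iff measurableSet_closedBall).2
        (integrableOn_const (measure_closedBall_lt_top).ne)
    have hineq : ∫ x, D * (w x ^ a * ‖gradient η x‖ ^ 2)
        ≤ ∫ x, (1 / 2 * (w x ^ (a + s) * η x ^ 2)
        + (Metric.closedBall (0 : 𝔼) (2 * R)).indicator (fun _ => 1 / 2 * L ^ p) x) :=
      integral_mono i1 (i2.add i3) hpt
    rw [integral_add i2 i3, integral_const_mul, integral_const_mul,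
      integral_indicator_const _ measurableSet_closedBall, Measure.real,
      Measure.addHaar_closedBall' _ _ (by positivity), ENNReal.toReal_mul,
      ENNReal.toReal_ofReal (by positivity), finrank_euclideanSpace_fin] at hineq
    have h1 := h η hη hηc
    have h2 : L ^ p * (2 * R) ^ N = L₀ ^ p * 2 ^ N * R ^ ((N : ℝ) - 2 * p) := by
      rw [Real.mul_rpow hL₀ (by positivity), mul_pow, Real.rpow_sub hR, Real.rpow_natCast,
        inv_pow, Real.inv_rpow (by positivity), ← Real.rpow_natCast R 2, ← Real.rpow_mul hR.le]
      push_cast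
      field_simp
    have h3 : ((2 * R) ^ N * V) • (1 / 2 * L ^ p)
        = 1 / 2 * (L₀ ^ p * 2 ^ N * V * R ^ ((N : ℝ) - 2 * p)) := by
      rw [smul_eq_mul, show L₀ ^ p * 2 ^ N * V * R ^ ((N : ℝ) - 2 * p)
        = (L₀ ^ p * 2 ^ N * R ^ ((N : ℝ) - 2 * p)) * V by ring, ← h2]
      ring
    have h4 := hineq.trans_eq (congrArg _ h3)
    linarith
  by_contra hne
  set R₀ := 1 + ‖x₀‖
  have hR₀ : 0 < R₀ := by positivity
  have hineq : ∀ R : ℝ, 0 < R → Continuous (fun x => w x ^ (a + s) * (ζ (R⁻¹ • x) ^ m) ^ 2) ∧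
      HasCompactSupport (fun x => w x ^ (a + s) * (ζ (R⁻¹ • x) ^ m) ^ 2) := fun R hR =>
    ⟨hcas.mul (((hζ R hR).1.continuous).pow 2),
      ((hζ R hR).2.1.comp_left (g := fun t : ℝ => (t ^ m) ^ 2)
        (by simp [show m ≠ 0 by omega])).mul_left⟩
  have hJ : 0 < ∫ x, w x ^ (a + s) * (ζ (R₀⁻¹ • x) ^ m) ^ 2 := by
    refine (hineq R₀ hR₀).1.integral_pos_of_hasCompactSupport_nonneg_nonzero (hineq R₀ hR₀).2
      (fun x => mul_nonneg (Real.rpow_nonneg (hw0 x) _) (sq_nonneg _)) (x := x₀) ?_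
    have : ζ (R₀⁻¹ • x₀) = 1 := by
      refine hζone _ ?_
      rw [norm_smul, Real.norm_eq_abs, abs_of_pos (inv_pos.2 hR₀), inv_mul_eq_div, div_le_one hR₀]
      simp [R₀]
    rw [this, one_pow, one_pow, mul_one]
    exact (Real.rpow_pos_of_pos (lt_of_le_of_ne (hw0 x₀) (Ne.symm hne)) _).ne'
  have hlim : Tendsto (fun R : ℝ => L₀ ^ p * 2 ^ N * V * R ^ ((N : ℝ) - 2 * p)) atTop (𝓝 0) := by
    have h1 := (tendsto_rpow_neg_atTop (y := 2 * p - N) (by linarith)).const_mul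
      (L₀ ^ p * 2 ^ N * V)
    simpa using h1
  refine hJ.not_ge (ge_of_tendsto hlim ?_)
  filter_upwards [eventually_ge_atTop (2 * R₀)] with R hR
  have hRpos : 0 < R := by linarith
  refine le_trans (integral_mono ((hineq R₀ hR₀).1.integrable_of_hasCompactSupport (hineq R₀ hR₀).2)
    ((hineq R hRpos).1.integrable_of_hasCompactSupport (hineq R hRpos).2) fun x => ?_)
    (hest R hRpos)
  refine mul_le_mul_of_nonneg_left ?_ (Real.rpow_nonneg (hw0 x) _)
  have hle : ζ (R₀⁻¹ • x) ≤ ζ (R⁻¹ • x) := by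
    rcases le_total ‖x‖ R with hx | hx
    · rw [hζone (R⁻¹ • x)]
      · exact hζ1 _
      · rwa [norm_smul, Real.norm_eq_abs, abs_of_pos (inv_pos.2 hRpos), inv_mul_eq_div,
          div_le_one hRpos]
    · rw [hζzero (R₀⁻¹ • x)]
      · exact hζ0 _
      · rw [norm_smul, Real.norm_eq_abs, abs_of_pos (inv_pos.2 hR₀), inv_mul_eq_div,
          le_div_iff₀ hR₀]
        exact hR.trans hx
  have := hζ0 (R₀⁻¹ • x)
  gcongr

end Scaling

/-! ### The test profiles -/

section Profile

/-- A `C¹` function equal to `t - t² / (2τ)` up to `τ` and to the constant `τ / 2` beyond. -/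
noncomputable def profile (τ t : ℝ) : ℝ := (τ ^ 2 - max (τ - t) 0 ^ 2) / (2 * τ)

variable {τ t : ℝ}

lemma profile_of_le (hτ : 0 < τ) (ht : t ≤ τ) : profile τ t = t - t ^ 2 / (2 * τ) := by
  rw [profile, max_eq_left (by linarith)]
  field_simp
  ring

lemma profile_of_ge (hτ : 0 < τ) (ht : τ ≤ t) : profile τ t = τ / 2 := by
  rw [profile, max_eq_right (by linarith)]
  field_simp
  ring

lemma hasDerivAt_profile (hτ : 0 < τ) (t : ℝ) :
    HasDerivAt (profile τ) (max (τ - t) 0 / τ) t := by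
  have hc : Continuous (profile τ) := by unfold profile; fun_prop
  have hne : ∀ y, y ≠ τ → HasDerivAt (profile τ) (max (τ - y) 0 / τ) y := by
    intro y hy
    rcases lt_or_gt_of_ne hy with h | h
    · have h1 : HasDerivAt ((fun t => t) - fun t => t ^ 2 / (2 * τ)) (max (τ - y) 0 / τ) y := by
        refine ((hasDerivAt_id' y).sub
          (((hasDerivAt_id' y).pow 2).div_const (2 * τ))).congr_deriv ?_
        rw [max_eq_left (by linarith)]
        field_simp
        push_cast
        ring
      refine h1.congr_of_eventuallyEq ?_
      filter_upwards [eventually_lt_nhds h] with z hz using profile_of_le hτ hz.le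
    · rw [max_eq_right (by linarith), zero_div]
      refine (hasDerivAt_const y (τ / 2)).congr_of_eventuallyEq ?_
      filter_upwards [eventually_gt_nhds h] with z hz using profile_of_ge hτ hz.le
  rcases eq_or_ne t τ with rfl | h
  · exact hasDerivAt_of_hasDerivAt_of_ne (g := fun y => max (t - y) 0 / t) hne hc.continuousAt
      (Continuous.continuousAt (by fun_prop))
  · exact hne t h

lemma contDiff_profile (hτ : 0 < τ) : ContDiff ℝ 1 (profile τ) := by
  refine contDiff_one_iff_deriv.2 ⟨fun t => (hasDerivAt_profile hτ t).differentiableAt, ?_⟩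
  rw [show deriv (profile τ) = fun t => max (τ - t) 0 / τ from
    funext fun t => (hasDerivAt_profile hτ t).deriv]
  fun_prop

lemma profile_pos (hτ : 0 < τ) (ht : 0 < t) : 0 < profile τ t := by
  rcases le_total t τ with h | h
  · rw [profile_of_le hτ h, sub_pos, div_lt_iff₀ (by positivity)]
    nlinarith
  · rw [profile_of_ge hτ h]; positivity

lemma profile_le (hτ : 0 < τ) : profile τ t ≤ t := by
  rcases le_total t τ with h | h
  · rw [profile_of_le hτ h]
    have : 0 ≤ t ^ 2 / (2 * τ) := by positivity
    linarith
  · rw [profile_of_ge hτ h]; linarith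

lemma mul_le_profile {T : ℝ} (hτ : 0 < τ) (hT : 0 < T) (ht : 0 < t) (htT : t ≤ T) :
    τ / (2 * (τ + T)) * t ≤ profile τ t := by
  rw [div_mul_eq_mul_div, div_le_iff₀ (by positivity)]
  rcases le_total t τ with h | h
  · have h1 : t / 2 ≤ profile τ t := by
      rw [profile_of_le hτ h, le_sub_iff_add_le, add_comm, ← le_sub_iff_add_le,
        div_le_iff₀ (by positivity)]
      nlinarith
    nlinarith
  · rw [profile_of_ge hτ h]
    nlinarith

lemma mul_deriv_le_profile (hτ : 0 < τ) (ht : 0 < t) : t * (max (τ - t) 0 / τ) ≤ profile τ t := by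
  rcases le_total t τ with h | h
  · rw [profile_of_le hτ h, max_eq_left (by linarith), mul_div_assoc', le_sub_iff_add_le,
      ← sub_nonneg]
    have : t - (t * (τ - t) / τ + t ^ 2 / (2 * τ)) = t ^ 2 / (2 * τ) := by field_simp; ring
    rw [this]
    positivity
  · rw [max_eq_right (by linarith), zero_div, mul_zero]
    exact (profile_pos hτ ht).le

/-- Multipliers `g` and `P`, both comparable to powers on `(0, T]`, whose derivatives satisfy the
inequality needed under `ρ f' ^ 2 ≤ f f''` below the level `τ`, and under mere convexity above. -/
lemma exists_multipliers {T β ρ : ℝ} (hτ : 0 < τ) (hT : 0 < T) (hβ : 0 < β) (hρ : β ^ 2 < ρ) :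
    ∃ g P : ℝ → ℝ, ∃ c θ : ℝ, 0 < c ∧ 0 < θ ∧ θ < 1 ∧
      ContDiffOn ℝ 1 g (Set.Ioi 0) ∧ ContDiffOn ℝ 1 P (Set.Ioi 0) ∧ ∀ t, 0 < t →
        0 ≤ P t ∧ P t ≤ g t * deriv g t ∧
        (t < τ → deriv g t ^ 2 ≤ ρ * (P t / t) + deriv P t) ∧
        (τ ≤ t → deriv g t ^ 2 ≤ deriv P t) ∧ 0 ≤ g t ∧ g t ≤ t ^ (1 + β) ∧
        (t ≤ T → t * P t ≤ θ * g t ^ 2 ∧ c * t ^ (1 + β) ≤ g t) := by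
  set l := (ρ - β ^ 2) / (2 * β + 1 + ρ) with hl
  have hρ0 : 0 < ρ := by nlinarith
  have hl0 : 0 < l := div_pos (by linarith) (by positivity)
  have hl1 : l < 1 := by rw [hl, div_lt_one (by positivity)]; nlinarith
  have hlρ : l * (2 * β + 1 + ρ) = ρ - β ^ 2 := div_mul_cancel₀ _ (by positivity)
  clear_value l
  set θ : ℝ → ℝ := fun t => 1 - l * Real.exp (-(t / τ)) with hθ
  have hθ' : ∀ t, HasDerivAt θ (l * Real.exp (-(t / τ)) / τ) t := by
    intro t
    refine ((((hasDerivAt_id' t).div_const τ).neg.exp.const_mul l).const_sub 1).congr_deriv ?_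
    simp only [Pi.neg_apply]
    ring
  set m := profile τ
  have hm' : ∀ t, HasDerivAt m (max (τ - t) 0 / τ) t := hasDerivAt_profile hτ
  have hm0 : ∀ t, 0 < t → 0 < m t := fun t => profile_pos hτ
  set g : ℝ → ℝ := fun t => t * m t ^ β with hg
  set P : ℝ → ℝ := fun t => t * (m t ^ β) ^ 2 * θ t with hP
  set h : ℝ → ℝ := fun t => 1 + β * (t * (max (τ - t) 0 / τ) / m t) with hh
  have hg' : ∀ t, 0 < t → HasDerivAt g (m t ^ β * h t) t := by
    intro t ht
    have hm := hm0 t ht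
    refine ((hasDerivAt_id' t).mul ((hm' t).rpow_const (p := β)
      (Or.inl hm.ne'))).congr_deriv ?_
    simp only [hh]
    rw [Real.rpow_sub_one hm.ne']
    field_simp
  have hP' : ∀ t, 0 < t → HasDerivAt P
      ((m t ^ β) ^ 2 * (l * Real.exp (-(t / τ)) / τ * t + θ t * (2 * h t - 1))) t := by
    intro t ht
    have hm := hm0 t ht
    refine (((hasDerivAt_id' t).mul (((hm' t).rpow_const (p := β)
      (Or.inl hm.ne')).pow 2)).mul (hθ' t)).congr_deriv ?_
    simp only [hh]
    rw [Real.rpow_sub_one hm.ne']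
    field_simp
    simp
    field_simp
    ring
  have hmc : ContDiffOn ℝ 1 (fun t => m t ^ β) (Set.Ioi 0) :=
    (contDiff_profile hτ).contDiffOn.rpow_const_of_ne fun t ht => (hm0 t ht).ne'
  refine ⟨g, P, (τ / (2 * (τ + T))) ^ β, θ T, by positivity, ?_, ?_, contDiffOn_id.mul hmc,
    (contDiffOn_id.mul (hmc.pow 2)).mul (ContDiff.contDiffOn (by fun_prop)), fun t ht => ?_⟩
  · have : Real.exp (-(T / τ)) ≤ 1 := Real.exp_le_one_iff.2 (neg_nonpos.2 (by positivity))
    simp only [hθ]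
    nlinarith
  · have := Real.exp_pos (-(T / τ))
    simp only [hθ]
    nlinarith
  rw [(hg' t ht).deriv, (hP' t ht).deriv]
  have hm := hm0 t ht
  have hM : 0 < m t ^ β := Real.rpow_pos_of_pos hm β
  have he := Real.exp_pos (-(t / τ))
  have he1 : Real.exp (-(t / τ)) ≤ 1 := Real.exp_le_one_iff.2 (neg_nonpos.2 (by positivity))
  have hθ1 : θ t ≤ 1 := by simp only [hθ]; nlinarith
  have hθl : 1 - l ≤ θ t := by simp only [hθ]; nlinarith
  have hh1 : 1 ≤ h t := by
    simp only [hh]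
    have : 0 ≤ max (τ - t) 0 := le_max_right _ _
    have : 0 ≤ β * (t * (max (τ - t) 0 / τ) / m t) := by positivity
    linarith
  have hhβ : h t ≤ 1 + β := by
    have := (div_le_one hm).2 (mul_deriv_le_profile hτ ht)
    simp only [hh]
    nlinarith
  have hθt : 0 ≤ l * Real.exp (-(t / τ)) / τ * t := by positivity
  refine ⟨?_, ?_, fun hlt => ?_, fun hge => ?_, by positivity, ?_, fun hle => ⟨?_, ?_⟩⟩
  · simp only [hP]
    exact mul_nonneg (by positivity) (by linarith)
  · calc P t = t * (m t ^ β) ^ 2 * θ t := rfl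
      _ ≤ t * (m t ^ β) ^ 2 * h t := by
        refine mul_le_mul_of_nonneg_left (by linarith) (by positivity)
      _ = _ := by simp only [hg]; ring
  · have e1 : P t / t = (m t ^ β) ^ 2 * θ t := by simp only [hP]; field_simp
    rw [e1, mul_pow, show ∀ a b c d : ℝ, a * (b * c) + b * d = b * (a * c + d) by intros; ring]
    refine mul_le_mul_of_nonneg_left ?_ (by positivity)
    have h1 : (1 - l) * (ρ + (2 * h t - 1)) ≤ θ t * (ρ + (2 * h t - 1)) :=
      mul_le_mul_of_nonneg_right hθl (by linarith)
    have h2 : l * (ρ + (2 * h t - 1)) ≤ l * (2 * β + 1 + ρ) :=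
      mul_le_mul_of_nonneg_left (by linarith) hl0.le
    nlinarith
  · have e1 : h t = 1 := by simp [hh, max_eq_right (sub_nonpos.2 hge)]
    rw [e1, mul_pow]
    refine mul_le_mul_of_nonneg_left ?_ (by positivity)
    have h1 : l * Real.exp (-(t / τ)) ≤ l * Real.exp (-(t / τ)) / τ * t := by
      rw [div_mul_eq_mul_div, mul_div_assoc]
      exact le_mul_of_one_le_right (mul_pos hl0 he).le ((one_le_div hτ).2 hge)
    simp only [hθ]
    linarith
  · rw [Real.rpow_add ht, Real.rpow_one]
    exact mul_le_mul_of_nonneg_left (Real.rpow_le_rpow hm.le (profile_le hτ) hβ.le) ht.le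
  · have h1 : θ t ≤ θ T := by
      simp only [hθ]
      gcongr
    calc t * P t = θ t * g t ^ 2 := by simp only [hP, hg]; ring
      _ ≤ _ := mul_le_mul_of_nonneg_right h1 (sq_nonneg _)
  · calc (τ / (2 * (τ + T))) ^ β * t ^ (1 + β) = t * (τ / (2 * (τ + T)) * t) ^ β := by
          rw [Real.rpow_add ht, Real.rpow_one, Real.mul_rpow (by positivity) ht.le]; ring
      _ ≤ g t := mul_le_mul_of_nonneg_left
          (Real.rpow_le_rpow (by positivity) (mul_le_profile hτ hT ht hle) hβ.le) ht.le

end Profile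

/-! ### The nonlinearity near zero -/

section Nonlinearity

variable {f : ℝ → ℝ}

lemma differentiableAt_of_contDiffOn_Ioi (hC2 : ContDiffOn ℝ 2 f (Set.Ioi 0)) {t : ℝ}
    (ht : 0 < t) : DifferentiableAt ℝ f t :=
  (hC2.differentiableOn (by norm_num)).differentiableAt (Ioi_mem_nhds ht)

lemma contDiffOn_deriv_Ioi (hC2 : ContDiffOn ℝ 2 f (Set.Ioi 0)) :
    ContDiffOn ℝ 1 (deriv f) (Set.Ioi 0) :=
  hC2.deriv_of_isOpen isOpen_Ioi (by norm_num)

lemma differentiableAt_deriv_of_contDiffOn_Ioi (hC2 : ContDiffOn ℝ 2 f (Set.Ioi 0)) {t : ℝ}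
    (ht : 0 < t) : DifferentiableAt ℝ (deriv f) t :=
  ((contDiffOn_deriv_Ioi hC2).differentiableOn (by norm_num)).differentiableAt (Ioi_mem_nhds ht)

lemma monotoneOn_deriv_Ioi (hC2 : ContDiffOn ℝ 2 f (Set.Ioi 0))
    (hconv : ConvexOn ℝ (Set.Ioi 0) f) : MonotoneOn (deriv f) (Set.Ioi 0) :=
  hconv.monotoneOn_deriv fun _ ht => differentiableAt_of_contDiffOn_Ioi hC2 ht

lemma deriv_deriv_nonneg (hC2 : ContDiffOn ℝ 2 f (Set.Ioi 0))
    (hconv : ConvexOn ℝ (Set.Ioi 0) f) {t : ℝ} (ht : 0 < t) : 0 ≤ deriv (deriv f) t := by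
  rw [← derivWithin_of_isOpen isOpen_Ioi ht]
  exact (monotoneOn_deriv_Ioi hC2 hconv).derivWithin_nonneg

lemma le_mul_deriv (hcont : ContinuousOn f (Set.Ici 0)) (hC2 : ContDiffOn ℝ 2 f (Set.Ioi 0))
    (hconv : ConvexOn ℝ (Set.Ioi 0) f) (h0 : f 0 = 0) {t : ℝ} (ht : 0 < t) :
    f t ≤ t * deriv f t := by
  have hlim : Tendsto (fun x => f t - f x - deriv f t * (t - x)) (𝓝[>] 0)
      (𝓝 (f t - f 0 - deriv f t * (t - 0))) := by
    have h1 : Tendsto f (𝓝[>] 0) (𝓝 (f 0)) :=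
      (hcont 0 Set.self_mem_Ici).mono_left (nhdsWithin_mono _ Set.Ioi_subset_Ici_self)
    have h2 : Tendsto (fun x : ℝ => x) (𝓝[>] 0) (𝓝 0) := tendsto_id.mono_left nhdsWithin_le_nhds
    exact (tendsto_const_nhds.sub h1).sub (tendsto_const_nhds.mul (tendsto_const_nhds.sub h2))
  have hle : f t - f 0 - deriv f t * (t - 0) ≤ 0 := by
    refine le_of_tendsto hlim ?_
    filter_upwards [Ioo_mem_nhdsGT ht] with x hx
    have := hconv.slope_le_deriv hx.1 ht hx.2 (differentiableAt_of_contDiffOn_Ioi hC2 ht)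
    rw [slope_def_field, div_le_iff₀ (sub_pos.2 hx.2)] at this
    linarith
  rw [h0] at hle
  linarith

lemma deriv_pos_of_convexOn (hcont : ContinuousOn f (Set.Ici 0))
    (hC2 : ContDiffOn ℝ 2 f (Set.Ioi 0)) (hconv : ConvexOn ℝ (Set.Ioi 0) f) (h0 : f 0 = 0)
    (hpos : ∀ t : ℝ, 0 < t → 0 < f t) {t : ℝ} (ht : 0 < t) : 0 < deriv f t :=
  pos_of_mul_pos_right ((hpos t ht).trans_le (le_mul_deriv hcont hC2 hconv h0 ht)) ht.le

lemma exists_mul_rpow_le_deriv (hC2 : ContDiffOn ℝ 2 f (Set.Ioi 0))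
    (hconv : ConvexOn ℝ (Set.Ioi 0) f) (hmono : MonotoneOn f (Set.Ici 0))
    (hpos : ∀ t : ℝ, 0 < t → 0 < f t) (hf' : ∀ t : ℝ, 0 < t → 0 < deriv f t) {s δ : ℝ}
    (hs : 0 < s) (hδ : 0 < δ)
    (hle : ∀ t ∈ Set.Ioo 0 δ, f t * deriv (deriv f) t ≤ s * deriv f t ^ 2) (M : ℝ) :
    ∃ c, 0 < c ∧ ∀ t ∈ Set.Ioc 0 M, c * f t ^ s ≤ deriv f t := by
  have hd : ∀ t, 0 < t → HasDerivAt (fun t => deriv f t * f t ^ (-s))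
      (deriv (deriv f) t * f t ^ (-s) + deriv f t * (deriv f t * -s * f t ^ (-s - 1))) t :=
    fun t ht => (differentiableAt_deriv_of_contDiffOn_Ioi hC2 ht).hasDerivAt.mul
      ((differentiableAt_of_contDiffOn_Ioi hC2 ht).hasDerivAt.rpow_const (Or.inl (hpos t ht).ne'))
  have hanti : AntitoneOn (fun t => deriv f t * f t ^ (-s)) (Set.Ioo 0 δ) := by
    refine antitoneOn_of_deriv_nonpos (convex_Ioo 0 δ)
      (fun t ht => (hd t ht.1).continuousAt.continuousWithinAt) ?_ ?_
    · rw [interior_Ioo]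
      exact fun t ht => (hd t ht.1).differentiableAt.differentiableWithinAt
    · rw [interior_Ioo]
      intro t ht
      have hft := hpos t ht.1
      rw [(hd t ht.1).deriv, Real.rpow_sub_one hft.ne']
      have h1 : deriv (deriv f) t * f t ^ (-s) + deriv f t * (deriv f t * -s * (f t ^ (-s) / f t))
          = f t ^ (-s) / f t * (f t * deriv (deriv f) t - s * deriv f t ^ 2) := by
        field_simp
        ring
      rw [h1]
      exact mul_nonpos_of_nonneg_of_nonpos (by positivity) (sub_nonpos.2 (hle t ht))
  set a := δ / 2
  have ha : 0 < a := by positivity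
  have haδ : a < δ := half_lt_self hδ
  set b := max M a
  have hb : 0 < b := ha.trans_le (le_max_right _ _)
  have hfb := hpos b hb
  have hfa := hf' a ha
  refine ⟨deriv f a * f b ^ (-s), by positivity, fun t ht => ?_⟩
  have hft := hpos t ht.1
  have hmul : ∀ z, 0 < z → f z ^ (-s) * f z ^ s = 1 := fun z hz => by
    rw [← Real.rpow_add (hpos z hz), neg_add_cancel, Real.rpow_zero]
  rcases le_total t a with h | h
  · have h1 : deriv f a * f a ^ (-s) ≤ deriv f t * f t ^ (-s) :=
      hanti ⟨ht.1, h.trans_lt haδ⟩ ⟨ha, haδ⟩ h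
    have h2 : f b ^ (-s) ≤ f a ^ (-s) :=
      Real.rpow_le_rpow_of_nonpos (hpos a ha) (hmono ha.le hb.le (le_max_right _ _)) (by linarith)
    calc deriv f a * f b ^ (-s) * f t ^ s ≤ deriv f t * f t ^ (-s) * f t ^ s := by
          refine mul_le_mul_of_nonneg_right (le_trans ?_ h1) (by positivity)
          gcongr
      _ = deriv f t := by rw [mul_assoc, hmul t ht.1, mul_one]
  · calc deriv f a * f b ^ (-s) * f t ^ s ≤ deriv f a * f b ^ (-s) * f b ^ s := by
          gcongr
          exact hmono ht.1.le hb.le (ht.2.trans (le_max_left _ _))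
      _ = deriv f a := by rw [mul_assoc, hmul b hb, mul_one]
      _ ≤ deriv f t := monotoneOn_deriv_Ioi hC2 hconv ha ht.1 h

lemma exists_Ioo_mul_deriv_deriv_le (hC2 : ContDiffOn ℝ 2 f (Set.Ioi 0))
    (hconv : ConvexOn ℝ (Set.Ioi 0) f) (hpos : ∀ t : ℝ, 0 < t → 0 < f t) {q₀ : ℝ≥0∞}
    (hq : Tendsto (qfun f) (𝓝[>] (0:ℝ)) (𝓝 q₀)) {s : ℝ} (hs : 0 < s)
    (hsq : ENNReal.ofReal (1 / s) < q₀) :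
    ∃ δ, 0 < δ ∧ ∀ t ∈ Set.Ioo 0 δ, f t * deriv (deriv f) t ≤ s * deriv f t ^ 2 := by
  obtain ⟨δ, hδ, h⟩ := mem_nhdsGT_iff_exists_Ioo_subset.1 (hq.eventually_const_lt hsq)
  refine ⟨δ, hδ, fun t ht => ?_⟩
  have hlt : ENNReal.ofReal (1 / s) < qfun f t := h ht
  rcases eq_or_ne (f t * deriv (deriv f) t) 0 with h0 | h0
  · rw [h0]; positivity
  · have hp : 0 < f t * deriv (deriv f) t :=
      lt_of_le_of_ne (mul_nonneg (hpos t ht.1).le (deriv_deriv_nonneg hC2 hconv ht.1)) h0.symm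
    rw [qfun, if_neg h0] at hlt
    have h1 := (ENNReal.ofReal_lt_ofReal_iff_of_nonneg (by positivity)).1 hlt
    rw [div_lt_div_iff₀ hs hp] at h1
    linarith

lemma exists_Ioo_le_mul_deriv_deriv (hC2 : ContDiffOn ℝ 2 f (Set.Ioi 0))
    (hconv : ConvexOn ℝ (Set.Ioi 0) f) (hpos : ∀ t : ℝ, 0 < t → 0 < f t) {q₀ : ℝ≥0∞}
    (hq : Tendsto (qfun f) (𝓝[>] (0:ℝ)) (𝓝 q₀)) {ρ : ℝ} (hρ : 0 < ρ)
    (hρq : q₀ < ENNReal.ofReal (1 / ρ)) :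
    ∃ δ, 0 < δ ∧ ∀ t ∈ Set.Ioo 0 δ, ρ * deriv f t ^ 2 ≤ f t * deriv (deriv f) t := by
  obtain ⟨δ, hδ, h⟩ := mem_nhdsGT_iff_exists_Ioo_subset.1 (hq.eventually_lt_const hρq)
  refine ⟨δ, hδ, fun t ht => ?_⟩
  have hlt : qfun f t < ENNReal.ofReal (1 / ρ) := h ht
  rcases eq_or_ne (f t * deriv (deriv f) t) 0 with h0 | h0
  · rw [qfun, if_pos h0] at hlt
    exact absurd hlt not_top_lt
  · have hp : 0 < f t * deriv (deriv f) t :=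
      lt_of_le_of_ne (mul_nonneg (hpos t ht.1).le (deriv_deriv_nonneg hC2 hconv ht.1)) h0.symm
    rw [qfun, if_neg h0] at hlt
    have h1 := (ENNReal.ofReal_lt_ofReal_iff_of_nonneg (by positivity)).1 hlt
    rw [div_lt_div_iff₀ hp hρ] at h1
    linarith

end Nonlinearity

/-! ### The exponents -/

section Exponents

lemma sub_two_lt_of_lt_pc {N : ℕ} {p Q : ℝ} (hN : 11 ≤ N) (hp : 0 < p) (hQ : 0 < Q)
    (hpQ : 1 / p + 1 / Q = 1) (hlt : p < pc N) : (N : ℝ) - 2 < 4 * Q + 4 * √Q := by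
  have hN' : (11 : ℝ) ≤ N := by exact_mod_cast hN
  set r := √((N : ℝ) - 1) with hr
  have hr2 : r ^ 2 = N - 1 := Real.sq_sqrt (by linarith)
  have hr3 : 3 < r := by rw [hr, Real.lt_sqrt (by norm_num)]; linarith
  have hNr : (N : ℝ) = r ^ 2 + 1 := by linarith
  have hpc : pc N = (r - 1) ^ 2 / ((r - 1) ^ 2 - 4) := by
    rw [pc, ← hr, hNr]
    have h1 : r - 1 ≠ 0 := by linarith
    have h2 : r - 3 ≠ 0 := by linarith
    have h3 : r + 1 ≠ 0 := by linarith
    rw [show (r ^ 2 + 1 - 2) * (r ^ 2 + 1 - 10) = (r - 1) * (r + 1) * ((r - 3) * (r + 3)) by ring,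
      show (r - 1) ^ 2 - 4 = (r + 1) * (r - 3) by ring]
    have h4 : r + 3 ≠ 0 := by linarith
    field_simp
    ring
  have hd : 0 < (r - 1) ^ 2 - 4 := by nlinarith
  rw [hpc, lt_div_iff₀ hd] at hlt
  have hpQ' : Q + p = p * Q := by
    field_simp at hpQ
    linarith
  have hp1 : 1 < p := by
    by_contra! h
    nlinarith
  have hQr : ((r - 1) / 2) ^ 2 < Q := by
    have h1 : (p - 1) * ((r - 1) / 2) ^ 2 < p := by linarith
    have h2 : p = (p - 1) * Q := by linarith
    rw [h2] at h1
    exact lt_of_mul_lt_mul_left (by linarith) (by linarith : 0 ≤ p - 1)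
  have hsq : (r - 1) / 2 < √Q := Real.lt_sqrt_of_sq_lt hQr
  nlinarith

lemma one_le_and_sub_two_lt {N : ℕ} {p₀ q₀ : ℝ≥0∞} (hpq : 1 / p₀ + 1 / q₀ = 1) (hq : q₀ ≠ ⊤)
    (hdim : N ≤ 9 ∨ (N = 10 ∧ p₀ < ⊤) ∨ (11 ≤ N ∧ p₀ < ENNReal.ofReal (pc N))) :
    1 ≤ q₀.toReal ∧ (N : ℝ) - 2 < 4 * q₀.toReal + 4 * √q₀.toReal := by
  have hq1 : 1 ≤ q₀ := by
    have : 1 / q₀ ≤ 1 := le_add_self.trans_eq hpq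
    rw [one_div] at this
    exact ENNReal.inv_le_one.1 this
  have hQ1 : 1 ≤ q₀.toReal := by
    rw [← ENNReal.toReal_one]; exact ENNReal.toReal_mono hq hq1
  have hp0 : p₀ ≠ 0 := by rintro rfl; simp at hpq
  have hq0 : q₀ ≠ 0 := by rintro rfl; simp at hq1
  have hreal : p₀ ≠ ⊤ → 1 / p₀.toReal + 1 / q₀.toReal = 1 := by
    intro hp
    have := congrArg ENNReal.toReal hpq
    rwa [ENNReal.toReal_add (by simp [hp0]) (by simp [hq0]), ENNReal.toReal_div,
      ENNReal.toReal_div, ENNReal.toReal_one] at this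
  have hsq : 1 ≤ √q₀.toReal := Real.one_le_sqrt.2 hQ1
  refine ⟨hQ1, ?_⟩
  rcases hdim with h | ⟨rfl, h⟩ | ⟨h, hlt⟩
  · have : (N : ℝ) ≤ 9 := by exact_mod_cast h
    linarith
  · have hp := ENNReal.toReal_pos hp0 h.ne
    have h1 := hreal h.ne
    have h2 : 1 < q₀.toReal := by
      refine lt_of_le_of_ne hQ1 fun h3 => ?_
      rw [← h3] at h1
      have : 0 < 1 / p₀.toReal := by positivity
      linarith
    push_cast
    linarith
  · have hp : p₀ ≠ ⊤ := (hlt.trans ENNReal.ofReal_lt_top).ne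
    refine sub_two_lt_of_lt_pc h (ENNReal.toReal_pos hp0 hp) (by linarith) (hreal hp) ?_
    exact (ENNReal.lt_ofReal_iff_toReal_lt hp).1 hlt

end Exponents

/-! ### The Liouville theorem -/

section Liouville

variable {N : ℕ}

local notation "𝔼" => EuclideanSpace ℝ (Fin N)

lemma not_forall_lap_le_neg (hN : 1 ≤ N) {u : 𝔼 → ℝ} (hu : ContDiff ℝ 2 u)
    (hnonneg : ∀ x, 0 ≤ u x) {c : ℝ} (hc : 0 < c) : ¬ ∀ x, lap u x ≤ -c := by
  intro h
  have hN' : (0 : ℝ) < N := by exact_mod_cast hN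
  set ε := c / (4 * N) with hε
  have hε0 : 0 < ε := by positivity
  have hsq : ContDiff ℝ 2 fun x : 𝔼 => ‖x‖ ^ 2 := contDiff_norm_sq ℝ
  have hcoer : Tendsto (fun x : 𝔼 => u x + ε * ‖x‖ ^ 2) (cocompact 𝔼) atTop :=
    tendsto_atTop_mono (fun x => le_add_of_nonneg_left (hnonneg x))
      (((tendsto_pow_atTop two_ne_zero).comp
        (tendsto_norm_cocompact_atTop (E := 𝔼))).const_mul_atTop hε0)
  obtain ⟨x, hx⟩ := (hu.continuous.add (continuous_const.mul hsq.continuous)).exists_forall_le hcoer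
  have h1 := lap_nonneg_of_isLocalMin (hu.add (contDiff_const.mul hsq))
    (Eventually.of_forall hx : IsLocalMin (fun x => u x + ε * ‖x‖ ^ 2) x)
  rw [lap_add_const_mul hu hsq, lap_norm_sq] at h1
  have h2 : ε * (2 * N) = c / 2 := by rw [hε]; field_simp; norm_num
  linarith [h x]

lemma comp_eq_zero_of_tendsto_top {f : ℝ → ℝ} {u : 𝔼 → ℝ} {M : ℝ}
    (hC2 : ContDiffOn ℝ 2 f (Set.Ioi 0))
    (hconv : ConvexOn ℝ (Set.Ioi 0) f) (hmono : MonotoneOn f (Set.Ici 0))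
    (hpos : ∀ t : ℝ, 0 < t → 0 < f t) (hf' : ∀ t : ℝ, 0 < t → 0 < deriv f t)
    (hq : Tendsto (qfun f) (𝓝[>] (0:ℝ)) (𝓝 ⊤)) (hu : ContDiff ℝ 2 u)
    (hupos : ∀ x, 0 < u x) (huM : ∀ x, u x ≤ M) (hsol : ∀ x, -lap u x = f (u x)) (x : 𝔼) :
    f (u x) = 0 := by
  set s : ℝ := 1 / (N + 3) with hs
  have hs0 : 0 < s := by positivity
  have hs2 : s < 1 / 2 := by
    rw [hs]
    exact one_div_lt_one_div_of_lt (by norm_num) (by have : (0 : ℝ) ≤ N := N.cast_nonneg; linarith)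
  obtain ⟨δ, hδ, hle⟩ := exists_Ioo_mul_deriv_deriv_le hC2 hconv hpos hq hs0 ENNReal.ofReal_lt_top
  obtain ⟨c, hc, hcf⟩ := exists_mul_rpow_le_deriv hC2 hconv hmono hpos hf' hs0 hδ hle M
  have hw : Continuous fun x => f (u x) := hC2.continuousOn.comp_continuous hu.continuous hupos
  have hw0 : ∀ x, 0 < f (u x) := fun x => hpos _ (hupos x)
  refine eq_zero_of_integral_le hw (fun x => (hw0 x).le) (a := 1 / 2 - s) (s := s) (D := 2 / c)
    (by linarith) hs0 (by positivity) ?_ (fun η hη hηc => ?_) x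
  · rw [sub_add_cancel, hs]
    field_simp
    linarith
  · rw [← integral_const_mul]
    simp only [← mul_assoc, sub_add_cancel]
    refine integral_le_of_supersolution (k := fun t => f t ^ (-(1 / 2) : ℝ)) hu hupos
      hC2.continuousOn hsol ?_ (fun x => ?_) ?_ ?_ (fun x => ?_) (fun x => ?_) hη hηc
    · exact (hC2.of_le (by norm_num)).rpow_const_of_ne fun t ht => (hpos t ht).ne'
    · have hd : deriv (fun t => f t ^ (-(1 / 2) : ℝ)) (u x) = _ :=
        ((differentiableAt_of_contDiffOn_Ioi hC2 (hupos x)).hasDerivAt.rpow_const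
          (p := -(1 / 2)) (Or.inl (hw0 x).ne')).deriv
      rw [hd]
      have hk := hcf (u x) ⟨hupos x, huM x⟩
      have e1 : (f (u x) ^ (-(1 / 2) : ℝ)) ^ 2
          = f (u x) ^ (1 / 2 - s) * (f (u x) ^ s * f (u x) ^ (-(1 / 2) - 1 : ℝ)) := by
        rw [← Real.rpow_natCast, ← Real.rpow_mul (hw0 x).le, ← Real.rpow_add (hw0 x),
          ← Real.rpow_add (hw0 x)]
        congr 1
        push_cast
        ring
      rw [e1]
      calc f (u x) ^ (1 / 2 - s) * (f (u x) ^ s * f (u x) ^ (-(1 / 2) - 1 : ℝ))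
          = 1 / c * f (u x) ^ (1 / 2 - s) * f (u x) ^ (-(1 / 2) - 1 : ℝ)
            * (c * f (u x) ^ s) := by field_simp
        _ ≤ 1 / c * f (u x) ^ (1 / 2 - s) * f (u x) ^ (-(1 / 2) - 1 : ℝ) * deriv f (u x) := by
          have := hw0 x
          gcongr
        _ = _ := by ring
    · exact hw.rpow_const fun x => Or.inl (hw0 x).ne'
    · exact continuous_const.mul (hw.rpow_const fun x => Or.inl (hw0 x).ne')
    · have := hw0 x
      positivity
    · refine le_of_eq ?_
      nth_rewrite 2 [← Real.rpow_one (f (u x))]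
      rw [← Real.rpow_add (hw0 x)]
      norm_num

lemma exists_rpow_exponents {r : ℝ} (hr : 0 < r) (hNr : ((N : ℝ) - 2) * r ^ 2 < 4 + 4 * r) :
    ∃ β ρ s : ℝ, 0 < β ∧ β ^ 2 < ρ ∧ ρ < r ^ 2 ∧ r ^ 2 < s ∧
      (N : ℝ) < 2 * ((2 * (1 + β) + s) / s) := by
  set b := max 0 (((N : ℝ) - 2) * r ^ 2 / 4 - 1) with hb
  have hb0 : 0 ≤ b := le_max_left _ _
  have hbr : b < r := max_lt hr (by linarith)
  have hbN : ((N : ℝ) - 2) * r ^ 2 / 4 - 1 ≤ b := le_max_right _ _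
  set β := (b + r) / 2 with hβ
  have hβ0 : 0 < β := by positivity
  have hβr : β < r := by rw [hβ]; linarith
  have hβ2 : β ^ 2 < r ^ 2 := by gcongr
  set gap := 4 * (1 + β) - ((N : ℝ) - 2) * r ^ 2 with hgap
  have hgap0 : 0 < gap := by rw [hgap, hβ]; linarith
  have hN0 : (0 : ℝ) ≤ N := N.cast_nonneg
  have hd : 0 < gap / (N + 1) := by positivity
  refine ⟨β, (β ^ 2 + r ^ 2) / 2, r ^ 2 + gap / (N + 1), hβ0, by linarith, by linarith,
    by linarith, ?_⟩
  have h1 : (N + 1) * (gap / (N + 1)) = gap := mul_div_cancel₀ _ (by positivity)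
  rw [mul_div_assoc', lt_div_iff₀ (by positivity)]
  nlinarith

lemma comp_eq_zero_of_stable {f : ℝ → ℝ} {u : 𝔼 → ℝ} {M β ρ s δ c : ℝ}
    (hC2 : ContDiffOn ℝ 2 f (Set.Ioi 0))
    (hconv : ConvexOn ℝ (Set.Ioi 0) f) (hmono : MonotoneOn f (Set.Ici 0))
    (hpos : ∀ t : ℝ, 0 < t → 0 < f t) (hf' : ∀ t : ℝ, 0 < t → 0 < deriv f t)
    (hβ : 0 < β) (hβρ : β ^ 2 < ρ) (hs : 0 < s) (hNs : (N : ℝ) < 2 * ((2 * (1 + β) + s) / s))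
    (hδ : 0 < δ) (hρδ : ∀ t ∈ Set.Ioo 0 δ, ρ * deriv f t ^ 2 ≤ f t * deriv (deriv f) t)
    (hc : 0 < c) (hcf : ∀ t ∈ Set.Ioc 0 M, c * f t ^ s ≤ deriv f t) (hu : ContDiff ℝ 2 u)
    (hupos : ∀ x, 0 < u x) (hM : 0 < M) (huM : ∀ x, u x ≤ M) (hsol : ∀ x, -lap u x = f (u x))
    (hstab : Stable (deriv f) u) (x : 𝔼) : f (u x) = 0 := by
  obtain ⟨g, P, d, θ, hd, hθ, hθ1, hg, hP, h⟩ :=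
    exists_multipliers (hpos δ hδ) (hpos M hM) hβ hβρ
  have hmaps : Set.MapsTo f (Set.Ioi 0) (Set.Ioi 0) := fun t ht => hpos t ht
  have hfd : ∀ t, 0 < t → HasDerivAt f (deriv f t) t := fun t ht =>
    (differentiableAt_of_contDiffOn_Ioi hC2 ht).hasDerivAt
  have hdiff : ∀ {G : ℝ → ℝ}, ContDiffOn ℝ 1 G (Set.Ioi 0) → ∀ t, 0 < t →
      HasDerivAt G (deriv G t) t := fun hG t ht =>
    ((hG.differentiableOn (by norm_num)).differentiableAt (Ioi_mem_nhds ht)).hasDerivAt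
  have hC1 : ContDiffOn ℝ 1 f (Set.Ioi 0) := hC2.of_le (by norm_num)
  have hf'1 := contDiffOn_deriv_Ioi hC2
  set ψ : ℝ → ℝ := fun t => g (f t)
  set K : ℝ → ℝ := fun t => deriv f t * P (f t)
  have hψ' : ∀ t, 0 < t → deriv ψ t = deriv g (f t) * deriv f t := fun t ht =>
    ((hdiff hg _ (hpos t ht)).comp t (hfd t ht)).deriv
  have hK' : ∀ t, 0 < t → deriv K t
      = deriv (deriv f) t * P (f t) + deriv f t * (deriv P (f t) * deriv f t) := fun t ht =>
    ((hdiff hf'1 t ht).mul ((hdiff hP _ (hpos t ht)).comp t (hfd t ht))).deriv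
  have hw : Continuous fun x => f (u x) := hC2.continuousOn.comp_continuous hu.continuous hupos
  have hw0 : ∀ x, 0 < f (u x) := fun x => hpos _ (hupos x)
  have hwT : ∀ x, f (u x) ≤ f M := fun x => hmono (hupos x).le hM.le (huM x)
  obtain ⟨μ, hμ1, hμ2⟩ : ∃ μ, 1 < μ ∧ μ * θ < 1 := by
    obtain ⟨μ, h1, h2⟩ := exists_between ((one_lt_div hθ).2 hθ1)
    exact ⟨μ, h1, (lt_div_iff₀ hθ).1 h2⟩
  set c₁ := (1 - μ * θ) * (c * d ^ 2) with hc₁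
  have hc₁0 : 0 < c₁ := mul_pos (by linarith) (by positivity)
  have hpow : ∀ x, (f (u x) ^ (1 + β)) ^ 2 = f (u x) ^ (2 * (1 + β)) := fun x => by
    rw [← Real.rpow_natCast, ← Real.rpow_mul (hw0 x).le, mul_comm]
    norm_num
  refine eq_zero_of_integral_le hw (fun x => (hw0 x).le) (a := 2 * (1 + β)) (s := s)
    (D := ((1 + μ) ^ 2 / (μ - 1) + 1) / c₁) (by positivity) hs
    (div_nonneg (add_nonneg (div_nonneg (sq_nonneg _) (by linarith)) zero_le_one) hc₁0.le) hNs
    (fun η hη hηc => ?_) x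
  rw [div_mul_eq_mul_div, le_div_iff₀ hc₁0, mul_comm, ← integral_const_mul]
  simp only [← mul_assoc c₁]
  refine integral_le_of_stable (ψ := ψ) (K := K) hu hupos hC2.continuousOn hf'1.continuousOn hsol
    hstab (hg.comp hC1 hmaps) (hf'1.mul (hP.comp hC1 hmaps)) hμ1 (fun x => ?_) (fun x => ?_)
    (fun x => ?_) (continuous_const.mul (hw.rpow_const fun x => Or.inl (hw0 x).ne'))
    (hw.rpow_const fun x => Or.inl (hw0 x).ne') (fun x => ?_) (fun x => ?_) hη hηc
  all_goals
    obtain ⟨hP0, hPg, hlow, hhigh, hg0, hgt, hT⟩ := h (f (u x)) (hw0 x)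
    have hf'x := hf' _ (hupos x)
  · rw [hψ' _ (hupos x), hK' _ (hupos x), mul_pow]
    have hf''x := deriv_deriv_nonneg hC2 hconv (hupos x)
    rcases lt_or_ge (f (u x)) (f δ) with hlt | hge
    · have huδ : u x < δ := lt_of_not_ge fun hle => hlt.not_ge (hmono hδ.le (hupos x).le hle)
      have h1 := mul_le_mul_of_nonneg_right (hρδ _ ⟨hupos x, huδ⟩)
        (div_nonneg hP0 (hw0 x).le)
      have h2 : f (u x) * deriv (deriv f) (u x) * (P (f (u x)) / f (u x))
          = deriv (deriv f) (u x) * P (f (u x)) := by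
        have := (hw0 x).ne'
        field_simp
      nlinarith [mul_le_mul_of_nonneg_right (hlow hlt) (sq_nonneg (deriv f (u x)))]
    · nlinarith [mul_le_mul_of_nonneg_right (hhigh hge) (sq_nonneg (deriv f (u x))),
        mul_nonneg hf''x hP0]
  · exact mul_nonneg hf'x.le hP0
  · rw [hψ' _ (hupos x)]
    calc K (u x) ≤ deriv f (u x) * (g (f (u x)) * deriv g (f (u x))) :=
          mul_le_mul_of_nonneg_left hPg hf'x.le
      _ = _ := by simp only [ψ]; ring
  · obtain ⟨hPθ, hdg⟩ := hT (hwT x)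
    have h1 : (d * f (u x) ^ (1 + β)) ^ 2 ≤ g (f (u x)) ^ 2 := by
      have := hw0 x
      gcongr
    have h2 := hcf (u x) ⟨hupos x, huM x⟩
    calc c₁ * f (u x) ^ (2 * (1 + β) + s)
        = (1 - μ * θ) * ((c * f (u x) ^ s) * (d * f (u x) ^ (1 + β)) ^ 2) := by
          rw [Real.rpow_add (hw0 x), ← hpow, hc₁]; ring
      _ ≤ (1 - μ * θ) * (deriv f (u x) * g (f (u x)) ^ 2) := by
          refine mul_le_mul_of_nonneg_left ?_ (by linarith)
          exact mul_le_mul h2 h1 (sq_nonneg _) hf'x.le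
      _ = deriv f (u x) * ψ (u x) ^ 2 - μ * (deriv f (u x) * (θ * g (f (u x)) ^ 2)) := by
          simp only [ψ]; ring
      _ ≤ deriv f (u x) * ψ (u x) ^ 2 - μ * (deriv f (u x) * (f (u x) * P (f (u x)))) := by
          have : 0 ≤ μ := by linarith
          gcongr
      _ = _ := by simp only [K]; ring
  · rw [← hpow]
    exact pow_le_pow_left₀ hg0 hgt 2

end Liouville

/-- Theorem 1.5: Liouville theorem for bounded nonnegative stable solutions of
`−Δu = f(u)` in `ℝ^N`, for nondecreasing convex positive `f` of power type near `0`. -/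
theorem stmt2 {N : ℕ} (hN : 1 ≤ N) (f : ℝ → ℝ)
    (hcont : ContinuousOn f (Set.Ici 0)) (hC2 : ContDiffOn ℝ 2 f (Set.Ioi 0))
    (hconv : ConvexOn ℝ (Set.Ioi 0) f) (hmono : MonotoneOn f (Set.Ici 0))
    (hpos : ∀ t : ℝ, 0 < t → 0 < f t)
    (q₀ p₀ : ℝ≥0∞) (hq : Tendsto (qfun f) (𝓝[>] (0:ℝ)) (𝓝 q₀))
    (hpq : 1 / p₀ + 1 / q₀ = 1)
    (u : EuclideanSpace ℝ (Fin N) → ℝ) (hu : ContDiff ℝ 2 u)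
    (hbd : ∃ M, ∀ x, |u x| ≤ M) (hnonneg : ∀ x, 0 ≤ u x)
    (hsol : ∀ x, -lap u x = f (u x)) (hstab : Stable (deriv f) u)
    (hdim : N ≤ 9 ∨ (N = 10 ∧ p₀ < ⊤) ∨ (11 ≤ N ∧ p₀ < ENNReal.ofReal (pc N))) :
    ∀ x, u x = 0 := by
  obtain ⟨M', hM'⟩ := hbd
  have h0 : f 0 = 0 := by
    by_contra h0
    have hge : 0 ≤ f 0 := by
      have hlim : Tendsto f (𝓝[>] 0) (𝓝 (f 0)) :=
        (hcont 0 Set.self_mem_Ici).mono_left (nhdsWithin_mono _ Set.Ioi_subset_Ici_self)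
      refine ge_of_tendsto hlim ?_
      filter_upwards [self_mem_nhdsWithin] with t ht using (hpos t ht).le
    refine not_forall_lap_le_neg hN hu hnonneg (lt_of_le_of_ne hge (Ne.symm h0)) fun x => ?_
    linarith [hsol x, hmono Set.self_mem_Ici (hnonneg x) (hnonneg x)]
  by_cases hz : ∃ z, u z = 0
  · obtain ⟨z, hz⟩ := hz
    refine eq_zero_of_lap_nonpos_of_eq_zero hu hnonneg (fun x => ?_) hz
    linarith [hsol x, hmono Set.self_mem_Ici (hnonneg x) (hnonneg x)]
  exfalso
  have hupos : ∀ x, 0 < u x := fun x =>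
    lt_of_le_of_ne (hnonneg x) fun h => hz ⟨x, h.symm⟩
  have huM : ∀ x, u x ≤ M' := fun x => (le_abs_self _).trans (hM' x)
  have hM : 0 < M' := (hupos 0).trans_le (huM 0)
  have hf' : ∀ t : ℝ, 0 < t → 0 < deriv f t := fun t ht =>
    deriv_pos_of_convexOn hcont hC2 hconv h0 hpos ht
  refine (hpos _ (hupos 0)).ne' ?_
  rcases eq_or_ne q₀ ⊤ with rfl | hqt
  · exact comp_eq_zero_of_tendsto_top hC2 hconv hmono hpos hf' hq hu hupos huM hsol 0
  obtain ⟨hQ1, hNQ⟩ := one_le_and_sub_two_lt hpq hqt hdim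
  set Q := q₀.toReal
  have hQ0 : 0 < Q := by linarith
  have hr2 : ((√Q)⁻¹) ^ 2 = Q⁻¹ := by rw [inv_pow, Real.sq_sqrt hQ0.le]
  have hr : 0 < (√Q)⁻¹ := inv_pos.2 (Real.sqrt_pos.2 hQ0)
  have hNr : ((N : ℝ) - 2) * (√Q)⁻¹ ^ 2 < 4 + 4 * (√Q)⁻¹ := by
    have h1 : 4 + 4 * (√Q)⁻¹ = (4 * Q + 4 * √Q) * (√Q)⁻¹ ^ 2 := by
      have h2 := Real.sq_sqrt hQ0.le
      have h3 : √Q ≠ 0 := (Real.sqrt_pos.2 hQ0).ne'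
      field_simp
      linarith
    rw [h1]
    exact mul_lt_mul_of_pos_right hNQ (by positivity)
  obtain ⟨β, ρ, s, hβ, hβρ, hρ, hs, hNs⟩ := exists_rpow_exponents hr hNr
  rw [hr2] at hρ hs
  have hρ0 : 0 < ρ := (sq_nonneg β).trans_lt hβρ
  have hs0 : 0 < s := (inv_pos.2 hQ0).trans hs
  have hqQ : q₀ = ENNReal.ofReal Q := (ENNReal.ofReal_toReal hqt).symm
  obtain ⟨δ, hδ, hρδ⟩ := exists_Ioo_le_mul_deriv_deriv hC2 hconv hpos hq hρ0 (by
    rw [hqQ, ENNReal.ofReal_lt_ofReal_iff_of_nonneg hQ0.le, one_div]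
    exact (lt_inv_comm₀ hρ0 hQ0).1 hρ)
  obtain ⟨δ', hδ', hsδ⟩ := exists_Ioo_mul_deriv_deriv_le hC2 hconv hpos hq hs0 (by
    rw [hqQ, ENNReal.ofReal_lt_ofReal_iff hQ0, one_div]
    exact (inv_lt_comm₀ hQ0 hs0).1 hs)
  obtain ⟨c, hc, hcf⟩ := exists_mul_rpow_le_deriv hC2 hconv hmono hpos hf' hs0 hδ' hsδ M'
  exact comp_eq_zero_of_stable hC2 hconv hmono hpos hf' hβ hβρ hs0 hNs hδ hρδ hc hcf hu hupos hM
    huM hsol hstab 0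
end
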